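/- arXiv:1407.1179 — 2 statements merged into one kernel-verified Lean document; each statement's English description precedes it below -/
import Mathlib

section
/- Let (X,T) be a minimal t.d.s., let d ≥ 1 be an integer and let x, y ∈ X. Then (x,y) ∈ RP^[d] if and only if for every open neighborhood U of y the set N(x,U) contains SG_d(P) for some infinite sequence P in ℤ. Moreover, (x,y) ∈ RP^[∞] if and only if for every open neighborhood U of y and every integer d ≥ 1 the set N(x,U) contains an SG_d-set. -/
open scoped Classical
open MeasureTheory Filter Topology

noncomputable section

/-- Integer iterate of a bijection `T` of a set: `zIter T n = T^n`. -/
def zIter {X : Type*} (T : Equiv.Perm X) (n : ℤ) : X → X := ⇑(T ^ n)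

/-- Integer iterate of a homeomorphism. -/
def hIter {X : Type*} [TopologicalSpace X] (T : X ≃ₜ X) (n : ℤ) : X → X :=
  zIter T.toEquiv n

/-- The integer nearest to `a`, with ties broken towards the smaller integer.
This is the `⌈·⌉` of the paper. -/
def nearInt (a : ℝ) : ℤ := if a - (⌊a⌋ : ℝ) ≤ 1/2 then ⌊a⌋ else ⌈a⌉

/-- The distance from `a` to the nearest integer, i.e. `‖a‖` in the paper. -/
def distInt (a : ℝ) : ℝ := |a - (nearInt a : ℝ)|

/-- Generalized polynomials of degree at most `d` (for `d ≥ 1`):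
`GP 1` is the smallest collection of functions `ℤ → ℝ` containing `n ↦ a n`
and closed under taking the nearest integer, scalar multiplication and finite sums;
`GP d` moreover contains every `GP e` for `e < d` and all functions
`n ↦ a₀ n^{p₀} ⌈f₁(n)⌉ ⋯ ⌈f k (n)⌉` with `f l ∈ GP (p l)` and `p₀ + ∑ p l = d`. -/
inductive GP : ℕ → (ℤ → ℝ) → Prop
  | lin (a : ℝ) : GP 1 (fun n => a * n)
  | mono {d : ℕ} (hd : 1 ≤ d) (a₀ : ℝ) (p₀ : ℕ) {k : ℕ} (p : Fin k → ℕ)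
      (f : Fin k → ℤ → ℝ) (hf : ∀ l, GP (p l) (f l)) (hsum : p₀ + ∑ l, p l = d) :
      GP d (fun n => a₀ * (n : ℝ) ^ p₀ * ∏ l, (nearInt (f l n) : ℝ))
  | incl {d e : ℕ} (hed : e < d) {f : ℤ → ℝ} (hf : GP e f) : GP d f
  | ceil {d : ℕ} {f : ℤ → ℝ} (hf : GP d f) : GP d (fun n => (nearInt (f n) : ℝ))
  | smul {d : ℕ} (c : ℝ) {f : ℤ → ℝ} (hf : GP d f) : GP d (fun n => c * f n)
  | add {d : ℕ} {f g : ℤ → ℝ} (hf : GP d f) (hg : GP d g) : GP d (fun n => f n + g n)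

/-- The bracket expression `L(a₁, …, a_ℓ) = a₁⌈L(a₂, …, a_ℓ)⌉`, `L(a) = a`. -/
def Lfun : List ℝ → ℝ
  | [] => 0
  | [a] => a
  | a :: b :: rest => a * (nearInt (Lfun (b :: rest)) : ℝ)

/-- Special generalized polynomials of degree at most `d`:
the functions `n ↦ L(n^{j₁} a₁, …, n^{j_ℓ} a_ℓ)` with `1 ≤ ℓ`, `j t ≥ 1`, `∑ j t ≤ d`. -/
def SGP (d : ℕ) (g : ℤ → ℝ) : Prop :=
  ∃ ℓ : ℕ, 1 ≤ ℓ ∧ ∃ (a : Fin ℓ → ℝ) (j : Fin ℓ → ℕ),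
    (∀ t, 1 ≤ j t) ∧ (∑ t, j t) ≤ d ∧
    g = fun n : ℤ => Lfun (List.ofFn fun t => (n : ℝ) ^ (j t) * a t)

/-- `FS({n i}) = {n_{i₁} + ⋯ + n_{i_k} : i₁ < ⋯ < i_k}`, the set of finite sums. -/
def FS {d : ℕ} (n : Fin d → ℤ) : Set ℤ :=
  { m | ∃ I : Finset (Fin d), I.Nonempty ∧ m = ∑ i ∈ I, n i }

/-- `SG d P`: sums `p_{i₁} + ⋯ + p_{i_k}` over strictly increasing finite index
sequences whose consecutive gaps are at most `d` (infinite sequence `P`). -/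
def SG (d : ℕ) (P : ℕ → ℤ) : Set ℤ :=
  { n | ∃ k : ℕ, ∃ i : Fin (k + 1) → ℕ, StrictMono i ∧
      (∀ t : Fin k, i t.succ - i t.castSucc ≤ d) ∧ n = ∑ t, P (i t) }

/-- `SGfin d P` : the same for a finite sequence `P` of length `m`. -/
def SGfin (d : ℕ) {m : ℕ} (P : Fin m → ℤ) : Set ℤ :=
  { n | ∃ k : ℕ, ∃ i : Fin (k + 1) → Fin m, StrictMono i ∧
      (∀ t : Fin k, (i t.succ : ℕ) - (i t.castSucc : ℕ) ≤ d) ∧ n = ∑ t, P (i t) }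

/-- A set of integers is syndetic if it has bounded gaps. -/
def Syndetic (A : Set ℤ) : Prop :=
  ∃ N : ℕ, ∀ i : ℤ, ∃ j, i ≤ j ∧ j ≤ i + N ∧ j ∈ A

/-- `F` has positive upper Banach density. -/
def PosUpperBanachDensity (F : Set ℤ) : Prop :=
  ∃ δ : ℝ, 0 < δ ∧ ∀ N : ℕ, ∃ (a : ℤ) (L : ℕ), N ≤ L ∧ 1 ≤ L ∧
    δ * L ≤ ((Finset.Icc a (a + L - 1)).filter (fun x => x ∈ F)).card

/-- A set `A ⊆ ℤ` contains finite IP-sets of arbitrarily long lengths. -/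
def ContainsArbLongFIP (A : Set ℤ) : Prop :=
  ∀ k : ℕ, 1 ≤ k → ∃ p : Fin k → ℤ, FS p ⊆ A

/-- A topological dynamical system `(X, T)` is minimal: every orbit is dense. -/
def MinimalTDS {X : Type*} [TopologicalSpace X] (T : X ≃ₜ X) : Prop :=
  ∀ x : X, Dense (Set.range fun n : ℤ => hIter T n x)

/-- `Nset T x U = N(x, U) = {n ∈ ℤ : Tⁿ x ∈ U}`. -/
def Nset {X : Type*} [TopologicalSpace X] (T : X ≃ₜ X) (x : X) (U : Set X) : Set ℤ :=
  { n : ℤ | hIter T n x ∈ U }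

/-- The regionally proximal relation of order `d`. -/
def RPd {X : Type*} [MetricSpace X] (T : X ≃ₜ X) (d : ℕ) (x y : X) : Prop :=
  ∀ δ : ℝ, 0 < δ → ∃ (x' y' : X) (n : Fin d → ℤ),
    dist x x' < δ ∧ dist y y' < δ ∧
    ∀ ε : Finset (Fin d), ε.Nonempty →
      dist (hIter T (∑ i ∈ ε, n i) x') (hIter T (∑ i ∈ ε, n i) y') < δ

/-- `S` is a set of `d`-topological recurrence. -/
def TopRecSet (d : ℕ) (S : Set ℤ) : Prop :=
  ∀ (X : Type) [MetricSpace X] [CompactSpace X] (T : X ≃ₜ X), MinimalTDS T →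
    ∀ U : Set X, IsOpen U → U.Nonempty →
      ∃ n ∈ S, (⋂ j ∈ Finset.range (d + 1), hIter T ((j : ℤ) * n) ⁻¹' U).Nonempty

/-- `S` is a set of `d`-recurrence (measurable recurrence). -/
def MeasRecSet (d : ℕ) (S : Set ℤ) : Prop :=
  ∀ (Y : Type) [MeasurableSpace Y] [StandardBorelSpace Y]
    (μ : Measure Y) [IsProbabilityMeasure μ] (T : Y ≃ᵐ Y),
    MeasurePreserving (⇑T) μ μ →
    ∀ A : Set Y, MeasurableSet A → 0 < μ A →
      ∃ n ∈ S, 0 < μ (⋂ j ∈ Finset.range (d + 1), zIter T.toEquiv ((j : ℤ) * n) ⁻¹' A)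

/-- `P` is a Birkhoff recurrence set of order `d`. -/
def BirkhoffRecSet (d : ℕ) (P : Set ℤ) : Prop :=
  ∀ (X : Type) [MetricSpace X] [CompactSpace X] (T : X ≃ₜ X), MinimalTDS T →
    ∀ U : Set X, IsOpen U → U.Nonempty →
      ∃ n : Fin d → ℤ, FS n ⊆ P ∧ (U ∩ ⋂ m ∈ FS n, hIter T m ⁻¹' U).Nonempty

/-- `F` is a Poincaré recurrence set of order `d`. -/
def PoincareRecSet (d : ℕ) (F : Set ℤ) : Prop :=
  ∀ (Y : Type) [MeasurableSpace Y] [StandardBorelSpace Y]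
    (μ : Measure Y) [IsProbabilityMeasure μ] (T : Y ≃ᵐ Y),
    MeasurePreserving (⇑T) μ μ →
    ∀ A : Set Y, MeasurableSet A → 0 < μ A →
      ∃ n : Fin d → ℤ, FS n ⊆ F ∧ 0 < μ (A ∩ ⋂ m ∈ FS n, zIter T.toEquiv m ⁻¹' A)

/-- The upper unitriangular matrix `M(a)` with entries `(M(a))_{i, i+k} = a i k`
(1-based indexing). -/
def Mmat (d : ℕ) (a : ℕ → ℕ → ℝ) : Matrix (Fin (d + 1)) (Fin (d + 1)) ℝ :=
  fun r c =>
    if (r : ℕ) = (c : ℕ) then 1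
    else if (r : ℕ) < (c : ℕ) then a ((r : ℕ) + 1) ((c : ℕ) - (r : ℕ)) else 0

/-- `P_ℓ(a; i, k) = ∑ a_i^{s₁} a_{i+s₁}^{s₂} ⋯`, sum over `(s₁,…,s_ℓ) ∈ {1,…,k}^ℓ`
with `s₁ + ⋯ + s_ℓ = k`. -/
def Ppoly (a : ℕ → ℕ → ℝ) (i k ℓ : ℕ) : ℝ :=
  ∑ s ∈ Finset.univ.filter (fun s : Fin ℓ → Fin k => (∑ t, ((s t : ℕ) + 1)) = k),
    ∏ t : Fin ℓ,
      a (i + ∑ u ∈ Finset.univ.filter (fun u : Fin ℓ => u < t), ((s u : ℕ) + 1))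
        ((s t : ℕ) + 1)

/-- The upper unitriangular matrix with superdiagonal `α₁, …, α_d` (1-based). -/
def Amat (d : ℕ) (α : ℕ → ℝ) : Matrix (Fin (d + 1)) (Fin (d + 1)) ℝ :=
  fun r c =>
    if (r : ℕ) = (c : ℕ) then 1
    else if (c : ℕ) = (r : ℕ) + 1 then α ((r : ℕ) + 1) else 0

end

namespace SGRP

/-! ### the reverse direction: sums with gaps -/

lemma hIter_add {X : Type*} [TopologicalSpace X] (T : X ≃ₜ X) (m n : ℤ) (a : X) :
    hIter T (m + n) a = hIter T m (hIter T n a) := by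
  simp [hIter, zIter, zpow_add]

lemma hIter_zero {X : Type*} [TopologicalSpace X] (T : X ≃ₜ X) (a : X) :
    hIter T 0 a = a := by
  simp [hIter, zIter]

lemma hIter_cont {X : Type*} [TopologicalSpace X] (T : X ≃ₜ X) (n : ℤ) :
    Continuous (hIter T n) := by
  have h1 : Continuous (hIter T 1) := by
    have : hIter T 1 = T := by ext a; simp [hIter, zIter]
    rw [this]; exact T.continuous
  have h2 : Continuous (hIter T (-1)) := by
    have : hIter T (-1) = T.symm := by
      ext a
      simp only [hIter, zIter, zpow_neg, zpow_one]
      rfl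
    rw [this]; exact T.symm.continuous
  induction n using Int.induction_on with
  | zero =>
    have : hIter T 0 = id := by ext a; simp [hIter_zero]
    rw [this]; exact continuous_id
  | succ i ih =>
    have : hIter T (i + 1) = hIter T i ∘ hIter T 1 := by ext a; simp [hIter_add]
    rw [this]; exact ih.comp h1
  | pred i ih =>
    have : hIter T (-i - 1) = hIter T (-i) ∘ hIter T (-1) := by
      ext a; rw [sub_eq_add_neg]; simp [hIter_add]
    rw [this]; exact ih.comp h2

lemma sum_mem_SG (d : ℕ) (P : ℕ → ℤ) (A : Finset ℕ) (hA : A.Nonempty)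
    (h : ∀ a ∈ A, (∃ b ∈ A, a < b) → ∃ b ∈ A, a < b ∧ b ≤ a + d) :
    ∑ a ∈ A, P a ∈ SG d P := by
  obtain ⟨k, hk⟩ : ∃ k, A.card = k + 1 := ⟨A.card - 1, by have := hA.card_pos; omega⟩
  refine ⟨k, A.orderEmbOfFin hk, (A.orderEmbOfFin hk).strictMono, ?_, ?_⟩
  · intro t
    set e := A.orderEmbOfFin hk
    have hlt : e t.castSucc < e t.succ := e.strictMono Fin.castSucc_lt_succ
    obtain ⟨b, hb, h1, h2⟩ := h (e t.castSucc) (A.orderEmbOfFin_mem hk _)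
      ⟨_, A.orderEmbOfFin_mem hk _, hlt⟩
    have : b ∈ Set.range e := by rw [Finset.range_orderEmbOfFin]; exact hb
    obtain ⟨s, rfl⟩ := this
    have h3 : t.castSucc < s := e.lt_iff_lt.1 h1
    have h4 : t.succ ≤ s := by
      rw [Fin.lt_def] at h3; rw [Fin.le_def]; simp at *; omega
    have h5 : e t.succ ≤ e s := e.monotone h4
    omega
  · conv_lhs => rw [← Finset.image_orderEmbOfFin_univ A hk]
    rw [Finset.sum_image]
    intro a _ b _ hab
    exact (A.orderEmbOfFin hk).injective hab

/-- partial class sum set: indices `d*k+i` with `k ∈ [s,s')`. -/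
def cls (d i s s' : ℕ) : Finset ℕ := (Finset.Ico s s').image (fun k => d * k + i)

lemma mem_cls {d i s s' n : ℕ} : n ∈ cls d i s s' ↔ ∃ k, s ≤ k ∧ k < s' ∧ d * k + i = n := by
  simp [cls, and_assoc]

lemma sum_cls (d : ℕ) (hd : 1 ≤ d) (P : ℕ → ℤ) (i s s' : ℕ) :
    ∑ a ∈ cls d i s s', P a = ∑ k ∈ Finset.Ico s s', P (d * k + i) := by
  unfold cls
  rw [Finset.sum_image]
  intro a _ b _ hab
  have : d * a = d * b := by simpa using hab
  exact Nat.eq_of_mul_eq_mul_left (by omega) this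

lemma cls_disj {d i j s s' t t' : ℕ} (hi : i < d) (hj : j < d) (hij : i ≠ j) :
    Disjoint (cls d i s s') (cls d j t t') := by
  rw [Finset.disjoint_left]
  intro n h1 h2
  obtain ⟨k, _, _, h⟩ := mem_cls.1 h1
  obtain ⟨l, _, _, h'⟩ := mem_cls.1 h2
  have e1 : n % d = i := by rw [← h, Nat.mul_add_mod]; exact Nat.mod_eq_of_lt hi
  have e2 : n % d = j := by rw [← h', Nat.mul_add_mod]; exact Nat.mod_eq_of_lt hj
  omega

/-- Full classes `B ⊆ {1,…,d-1}` up to `K`, together with a segment of class `0`. -/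
lemma cls_SG (d : ℕ) (hd : 1 ≤ d) (P : ℕ → ℤ) (K s s' : ℕ) (hs' : s' ≤ K) (hss : s ≤ s')
    (B : Finset ℕ) (hB : ∀ i ∈ B, 1 ≤ i ∧ i < d) (hne : B.Nonempty ∧ 0 < K ∨ s < s') :
    (∑ i ∈ B, ∑ k ∈ Finset.range K, P (d * k + i)) + ∑ k ∈ Finset.Ico s s', P (d * k)
      ∈ SG d P := by
  set A : Finset ℕ := B.biUnion (fun i => cls d i 0 K) ∪ cls d 0 s s' with hA
  have hsum : ∑ a ∈ A, P a = (∑ i ∈ B, ∑ k ∈ Finset.range K, P (d * k + i))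
      + ∑ k ∈ Finset.Ico s s', P (d * k) := by
    rw [hA, Finset.sum_union, Finset.sum_biUnion]
    · rw [sum_cls d hd]
      congr 1
      refine Finset.sum_congr rfl fun i _ => ?_
      rw [sum_cls d hd]
      simp
    · intro i hi j hj hij
      exact cls_disj (hB i hi).2 (hB j hj).2 hij
    · rw [Finset.disjoint_biUnion_left]
      intro i hi
      exact cls_disj (hB i hi).2 (by omega) (by have := (hB i hi).1; omega)
  rw [← hsum]
  have memA : ∀ n, n ∈ A ↔ (∃ i ∈ B, ∃ k, k < K ∧ d * k + i = n) ∨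
      ∃ k, s ≤ k ∧ k < s' ∧ d * k = n := by
    intro n; simp [hA, mem_cls]
  apply sum_mem_SG
  · rcases hne with ⟨⟨i, hi⟩, hK⟩ | h
    · exact ⟨_, (memA _).2 (Or.inl ⟨i, hi, 0, hK, rfl⟩)⟩
    · exact ⟨_, (memA _).2 (Or.inr ⟨s, le_rfl, h, rfl⟩)⟩
  · rintro a ha ⟨b, hb, hab⟩
    by_cases hbd : b ≤ a + d
    · exact ⟨b, hb, hab, hbd⟩
    push Not at hbd
    -- `b < d * K`
    have hbK : b < d * K := by
      rcases (memA b).1 hb with ⟨i, hi, k, hk, rfl⟩ | ⟨k, _, hk, rfl⟩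
      · have := (hB i hi).2
        have : d * (k + 1) ≤ d * K := Nat.mul_le_mul_left d (by omega)
        rw [Nat.mul_add] at this; omega
      · exact Nat.mul_lt_mul_of_pos_left (by omega) (by omega)
    rcases (memA a).1 ha with ⟨i, hi, k, hk, rfl⟩ | ⟨k, hk0, hk, rfl⟩
    · refine ⟨d * (k + 1) + i, (memA _).2 (Or.inl ⟨i, hi, k + 1, ?_, rfl⟩), ?_, ?_⟩
      · have h1 := (hB i hi).2
        by_contra hcon
        have : d * K ≤ d * (k + 1) := Nat.mul_le_mul_left d (by omega)
        rw [Nat.mul_add] at this; omega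
      · rw [Nat.mul_add]; omega
      · rw [Nat.mul_add]; omega
    · rcases B.eq_empty_or_nonempty with hBe | ⟨i, hi⟩
      · rcases (memA b).1 hb with ⟨i, hi, _⟩ | ⟨l, hl0, hl, rfl⟩
        · simp [hBe] at hi
        · have hkl : k < l := Nat.lt_of_mul_lt_mul_left hab
          refine ⟨d * (k + 1), (memA _).2 (Or.inr ⟨k + 1, by omega, by omega, rfl⟩), ?_, ?_⟩
          · rw [Nat.mul_add]; omega
          · rw [Nat.mul_add]; omega
      · have := hB i hi
        exact ⟨d * k + i, (memA _).2 (Or.inl ⟨i, hi, k, by omega, rfl⟩), by omega, by omega⟩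

lemma RPd_of_SG {X : Type} [MetricSpace X] [CompactSpace X] (T : X ≃ₜ X) (d : ℕ) (hd : 1 ≤ d)
    (x y : X)
    (h : ∀ U : Set X, IsOpen U → y ∈ U → ∃ P : ℕ → ℤ, SG d P ⊆ Nset T x U) :
    RPd T d x y := by
  intro δ hδ
  obtain ⟨P, hP⟩ := h (Metric.ball y (δ/2)) Metric.isOpen_ball (Metric.mem_ball_self (by linarith))
  obtain ⟨c, -, hfin, hc⟩ := Metric.totallyBounded_iff.1
    (isCompact_univ (X := X)).totallyBounded (δ/2) (by linarith) |>.imp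
      (fun c hc => (⟨trivial, hc.1, hc.2⟩ : True ∧ _ ∧ _))
  have : ∀ z : X, ∃ a : c, dist z a < δ/2 := by
    intro z
    have := hc (Set.mem_univ z)
    simp only [Set.mem_iUnion, Metric.mem_ball] at this
    obtain ⟨a, ha, hz⟩ := this
    exact ⟨⟨a, ha⟩, hz⟩
  choose col hcol using this
  haveI := hfin.to_subtype
  haveI := Fintype.ofFinite c
  let Idx := Finset (Fin d)
  set K := Fintype.card (Idx → c) + 1 with hKdef
  let q : Fin d → ℤ := fun i => ∑ k ∈ Finset.range K, P (d * k + i)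
  let z0 : Fin d := ⟨0, by omega⟩
  let S0 : ℕ → ℤ := fun s => ∑ k ∈ Finset.range s, P (d * k)
  let color : Fin K → (Idx → c) := fun s ε =>
    col (hIter T ((∑ i ∈ ε.erase z0, q i) - S0 s) x)
  obtain ⟨s₁, s₂, hne, hcs⟩ := Fintype.exists_ne_map_eq_of_card_lt color (by simp [hKdef])
  wlog hlt : s₁ < s₂ generalizing s₁ s₂
  · exact this s₂ s₁ hne.symm hcs.symm (lt_of_le_of_ne (not_lt.1 hlt) hne.symm)
  have hlt' : (s₁ : ℕ) < s₂ := hlt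
  let a : ℤ := ∑ k ∈ Finset.Ico (s₁ : ℕ) s₂, P (d * k)
  have ha : S0 s₂ = S0 s₁ + a := by
    simp only [S0, a]
    rw [Finset.sum_range_add_sum_Ico _ hlt'.le]
  have qB : ∀ ε : Finset (Fin d), z0 ∉ ε → ∑ i ∈ ε, q i =
      ∑ i ∈ ε.map Fin.valEmbedding, ∑ k ∈ Finset.range K, P (d * k + i) := by
    intro ε _; rw [Finset.sum_map]; rfl
  have hBok : ∀ ε : Finset (Fin d), z0 ∉ ε → ∀ i ∈ ε.map Fin.valEmbedding, 1 ≤ i ∧ i < d := by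
    intro ε hε i hi
    simp only [Finset.mem_map, Fin.valEmbedding_apply] at hi
    obtain ⟨j, hj, rfl⟩ := hi
    refine ⟨?_, j.2⟩
    by_contra hcon
    have : j = z0 := Fin.ext (by simp [z0]; omega)
    exact hε (this ▸ hj)
  have near : ∀ ε : Finset (Fin d), z0 ∉ ε → 
      dist (hIter T ((∑ i ∈ ε, q i) + a) x) y < δ/2 := by
    intro ε hε
    rw [qB ε hε]
    exact hP (cls_SG d hd P K s₁ s₂ s₂.2.le hlt'.le _ (hBok ε hε) (Or.inr hlt'))
  have near0 : ∀ ε : Finset (Fin d), z0 ∉ ε → ε.Nonempty →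
      dist (hIter T (∑ i ∈ ε, q i) x) y < δ/2 := by
    intro ε hε hne
    rw [qB ε hε]
    have := cls_SG d hd P K 0 0 (Nat.zero_le _) le_rfl _ (hBok ε hε)
      (Or.inl ⟨hne.map, by omega⟩)
    simp only [Finset.Ico_self, Finset.sum_empty, add_zero] at this
    exact hP this
  refine ⟨x, hIter T a x, fun i => if i = z0 then - S0 s₂ else q i, by simpa using hδ, ?_, ?_⟩
  · have := near ∅ (by simp)
    rw [dist_comm]; simp at this; linarith
  · intro ε hε
    rw [← hIter_add]
    by_cases h0 : z0 ∈ ε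
    · have e1 : ∑ i ∈ ε, (if i = z0 then - S0 s₂ else q i) = (∑ i ∈ ε.erase z0, q i) - S0 s₂ := by
        rw [← Finset.add_sum_erase _ _ h0]
        rw [if_pos rfl, Finset.sum_congr rfl (fun i hi => if_neg (Finset.ne_of_mem_erase hi))]
        ring
      rw [e1]
      have e2 : (∑ i ∈ ε.erase z0, q i) - S0 s₂ + a = (∑ i ∈ ε.erase z0, q i) - S0 s₁ := by
        rw [ha]; ring
      rw [e2]
      have := congrFun hcs ε
      simp only [color] at this
      have h1 := hcol (hIter T ((∑ i ∈ ε.erase z0, q i) - S0 s₁) x)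
      have h2 := hcol (hIter T ((∑ i ∈ ε.erase z0, q i) - S0 s₂) x)
      rw [this] at h1
      calc _ ≤ _ := dist_triangle_right _ _ _
        _ < δ := by linarith
    · have e1 : ∑ i ∈ ε, (if i = z0 then - S0 s₂ else q i) = ∑ i ∈ ε, q i := by
        refine Finset.sum_congr rfl fun i hi => ?_
        rw [if_neg]; rintro rfl; exact h0 hi
      rw [e1]
      calc _ ≤ _ := dist_triangle_right _ _ y
        _ < δ := by linarith [near ε h0, near0 ε h0 hε]


/-! ### compact right topological semigroups -/

section abstr

variable {S : Type*} [Monoid S] [TopologicalSpace S]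

lemma closure_mul (hr : ∀ q : S, Continuous (· * q)) {A : Set S}
    (hA : ∀ a ∈ A, ∀ b ∈ A, a * b ∈ A) (hl : ∀ a ∈ A, Continuous (fun b => a * b))
    {a b : S} (ha : a ∈ closure A) (hb : b ∈ closure A) : a * b ∈ closure A := by
  have h1 : ∀ a ∈ A, ∀ b ∈ closure A, a * b ∈ closure A := fun a ha b hb =>
    map_mem_closure (hl a ha) hb (fun c hc => hA a ha c hc)
  have h2 := map_mem_closure (hr b) ha (t := closure A) (fun c hc => h1 c hc b hb)
  rwa [closure_closure] at h2

structure MinId (E M : Set S) : Prop where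
  sub : M ⊆ E
  ne : M.Nonempty
  cl : IsClosed M
  ideal : ∀ e ∈ E, ∀ p ∈ M, e * p ∈ M
  tr : ∀ p ∈ M, ∀ q ∈ M, ∃ e ∈ E, e * p = q

lemma exists_minId [T2Space S] [CompactSpace S] (hr : ∀ q : S, Continuous (· * q)) (E : Set S)
    (hEc : IsClosed E) (hE1 : (1 : S) ∈ E) (hEm : ∀ a ∈ E, ∀ b ∈ E, a * b ∈ E) :
    ∃ M, MinId E M := by
  let Z : Set (Set S) := {I | I ⊆ E ∧ I.Nonempty ∧ IsClosed I ∧ ∀ e ∈ E, ∀ p ∈ I, e * p ∈ I}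
  have hEZ : E ∈ Z := ⟨subset_rfl, ⟨1, hE1⟩, hEc, hEm⟩
  obtain ⟨M, -, hM⟩ := zorn_superset_nonempty Z (by
    intro c hc hch hne
    refine ⟨⋂₀ c, ⟨?_, ?_, ?_, ?_⟩, fun s hs => Set.sInter_subset_of_mem hs⟩
    · obtain ⟨s, hs⟩ := hne
      exact (Set.sInter_subset_of_mem hs).trans (hc hs).1
    · haveI := hne.to_subtype
      exact IsCompact.nonempty_sInter_of_directed_nonempty_isCompact_isClosed
        (by
          intro a ha b hb
          rcases hch.total ha hb with h | h
          · exact ⟨a, ha, subset_rfl, h⟩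
          · exact ⟨b, hb, h, subset_rfl⟩) (fun s hs => (hc hs).2.1)
        (fun s hs => (hc hs).2.2.1.isCompact) (fun s hs => (hc hs).2.2.1)
    · exact isClosed_sInter fun s hs => (hc hs).2.2.1
    · intro e he p hp s hs
      exact (hc hs).2.2.2 e he p (hp s hs)) E hEZ
  have hMZ := hM.prop
  refine ⟨M, hMZ.1, hMZ.2.1, hMZ.2.2.1, hMZ.2.2.2, ?_⟩
  intro p hp q hq
  have hI : (fun e => e * p) '' E ∈ Z := by
    refine ⟨?_, ⟨_, 1, hE1, rfl⟩, (hEc.isCompact.image (hr p)).isClosed, ?_⟩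
    · rintro _ ⟨e, he, rfl⟩
      exact hEm e he p (hMZ.1 hp)
    · rintro e he _ ⟨e', he', rfl⟩
      exact ⟨e * e', hEm e he e' he', mul_assoc _ _ _⟩
  have hle : (fun e => e * p) '' E ≤ M := by
    rintro _ ⟨e, he, rfl⟩
    exact hMZ.2.2.2 e he p hp
  have := hM.le_of_le hI hle
  obtain ⟨e, he, h⟩ := this hq
  exact ⟨e, he, h⟩

lemma MinId.idem_right {E M : Set S} (h : MinId E M) {v p : S} (hv : v ∈ M) (hvv : v * v = v)
    (hp : p ∈ M) : p * v = p := by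
  obtain ⟨e, -, rfl⟩ := h.tr v hv p hp
  rw [mul_assoc, hvv]

end abstr

section enveloping

variable {X : Type} [MetricSpace X] [CompactSpace X]

instance : TopologicalSpace (Function.End X) := inferInstanceAs (TopologicalSpace (X → X))
instance : CompactSpace (Function.End X) := inferInstanceAs (CompactSpace (X → X))
instance : T2Space (Function.End X) := inferInstanceAs (T2Space (X → X))

lemma end_apply_cont (x : X) : Continuous (fun s : Function.End X => s x) :=
  continuous_apply (A := fun _ : X => X) x

lemma end_cont {Y : Type*} [TopologicalSpace Y] (f : Y → Function.End X)
    (h : ∀ x, Continuous (fun y => f y x)) : Continuous f :=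
  continuous_pi (A := fun _ : X => X) h

lemma end_right (q : Function.End X) : Continuous (· * q) :=
  end_cont _ fun x => end_apply_cont (q x)

lemma end_left (q : Function.End X) (hq : Continuous (q : X → X)) :
    Continuous (fun s => q * s) :=
  end_cont _ fun x => hq.comp (end_apply_cont x)

def tau (T : X ≃ₜ X) (n : ℤ) : Function.End X := hIter T n

lemma tau_add (T : X ≃ₜ X) (m n : ℤ) : tau T (m + n) = tau T m * tau T n := by
  funext a; exact hIter_add T m n a

lemma tau_zero (T : X ≃ₜ X) : tau T 0 = 1 := by
  funext a; exact hIter_zero T a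

lemma tau_cont (T : X ≃ₜ X) (n : ℤ) : Continuous (tau T n : X → X) := hIter_cont T n

lemma tau_comm (T : X ≃ₜ X) (m n : ℤ) : tau T m * tau T n = tau T n * tau T m := by
  rw [← tau_add, ← tau_add, add_comm]

def E1 (T : X ≃ₜ X) : Set (Function.End X) := closure (Set.range (tau T))

lemma E1_mul (T : X ≃ₜ X) {a b : Function.End X} (ha : a ∈ E1 T) (hb : b ∈ E1 T) :
    a * b ∈ E1 T := by
  refine closure_mul end_right ?_ ?_ ha hb
  · rintro _ ⟨m, rfl⟩ _ ⟨n, rfl⟩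
    exact ⟨m + n, tau_add T m n⟩
  · rintro _ ⟨m, rfl⟩
    exact end_left _ (tau_cont T m)

lemma E1_one (T : X ≃ₜ X) : (1 : Function.End X) ∈ E1 T :=
  subset_closure ⟨0, tau_zero T⟩

lemma E1_orbit (T : X ≃ₜ X) (hmin : MinimalTDS T) (x y : X) : ∃ e ∈ E1 T, e x = y := by
  have hc : IsClosed ((fun s : Function.End X => s x) '' E1 T) :=
    (isClosed_closure.isCompact.image (end_apply_cont x)).isClosed
  have : closure (Set.range fun n : ℤ => hIter T n x) ⊆ (fun s : Function.End X => s x) '' E1 T := by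
    refine closure_minimal ?_ hc
    rintro _ ⟨n, rfl⟩
    exact ⟨tau T n, subset_closure ⟨n, rfl⟩, rfl⟩
  rw [(hmin x).closure_eq] at this
  exact this (Set.mem_univ y)

lemma exists_idem (T : X ≃ₜ X) (hmin : MinimalTDS T) {M : Set (Function.End X)}
    (hM : MinId (E1 T) M) (x : X) : ∃ v ∈ M, v * v = v ∧ v x = x := by
  obtain ⟨p, hp⟩ := hM.ne
  obtain ⟨e, he, hex⟩ := E1_orbit T hmin (p x) x
  obtain ⟨v, hv, hvv⟩ := exists_idempotent_in_compact_subsemigroup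
    (fun r : Function.End X => end_right r) (M ∩ {s | s x = x})
    ⟨e * p, hM.ideal e he p hp, hex⟩
    (hM.cl.inter (isClosed_eq (end_apply_cont x) continuous_const)).isCompact
    (by
      rintro a ⟨ha, hax⟩ b ⟨hb, hbx⟩
      refine ⟨hM.ideal a (hM.sub ha) b hb, ?_⟩
      change a (b x) = x
      have h1 : b x = x := hbx
      have h2 : a x = x := hax
      rw [h1, h2])
  exact ⟨v, hv.1, hvv, hv.2⟩

/-! ### cubes -/

variable {D : ℕ}

abbrev Cube (D : ℕ) (X : Type) := Finset (Fin D) → Function.End X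

lemma cube_right (q : Cube D X) : Continuous (· * q) :=
  continuous_pi fun ε => (end_right (q ε)).comp (continuous_apply ε)

lemma cube_left (q : Cube D X) (hq : ∀ ε, Continuous (q ε : X → X)) :
    Continuous (fun s => q * s) :=
  continuous_pi fun ε => (end_left (q ε) (hq ε)).comp (continuous_apply ε)

def FF (T : X ≃ₜ X) (n : Fin D → ℤ) : Cube D X := fun ε => tau T (∑ i ∈ ε, n i)
def GG (T : X ≃ₜ X) (m : ℤ) (n : Fin D → ℤ) : Cube D X := fun ε => tau T (m + ∑ i ∈ ε, n i)

def EF (T : X ≃ₜ X) (D : ℕ) : Set (Cube D X) := closure (Set.range (FF T))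
def EG (T : X ≃ₜ X) (D : ℕ) : Set (Cube D X) :=
  closure (Set.range fun p : ℤ × (Fin D → ℤ) => GG T p.1 p.2)

lemma EF_mul (T : X ≃ₜ X) {a b : Cube D X} (ha : a ∈ EF T D) (hb : b ∈ EF T D) :
    a * b ∈ EF T D := by
  refine closure_mul cube_right ?_ ?_ ha hb
  · rintro _ ⟨m, rfl⟩ _ ⟨n, rfl⟩
    refine ⟨m + n, ?_⟩
    funext ε
    simp [FF, Finset.sum_add_distrib, tau_add]
  · rintro _ ⟨m, rfl⟩
    exact cube_left _ fun ε => tau_cont T _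

lemma EG_mul (T : X ≃ₜ X) {a b : Cube D X} (ha : a ∈ EG T D) (hb : b ∈ EG T D) :
    a * b ∈ EG T D := by
  refine closure_mul cube_right ?_ ?_ ha hb
  · rintro _ ⟨⟨m, n⟩, rfl⟩ _ ⟨⟨m', n'⟩, rfl⟩
    refine ⟨(m + m', n + n'), ?_⟩
    funext ε
    simp only [GG, Pi.add_apply, Pi.mul_apply, Finset.sum_add_distrib, ← tau_add]
    congr 1; ring
  · rintro _ ⟨m, rfl⟩
    exact cube_left _ fun ε => tau_cont T _

lemma EF_one (T : X ≃ₜ X) : (1 : Cube D X) ∈ EF T D :=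
  subset_closure ⟨0, by funext ε; simp [FF, tau_zero]⟩

lemma EF_sub_EG (T : X ≃ₜ X) : EF T D ⊆ EG T D := by
  refine closure_mono ?_
  rintro _ ⟨n, rfl⟩
  exact ⟨(0, n), by funext ε; simp [GG, FF]⟩

lemma EF_FF (T : X ≃ₜ X) (n : Fin D → ℤ) : FF T n ∈ EF T D := subset_closure ⟨n, rfl⟩

lemma EG_comp (T : X ≃ₜ X) {q : Cube D X} (hq : q ∈ EG T D) (ε) : q ε ∈ E1 T :=
  map_mem_closure (f := fun q : Cube D X => q ε) (continuous_apply ε) hq (by rintro _ ⟨p, rfl⟩; exact ⟨_, rfl⟩)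

lemma EF_comp (T : X ≃ₜ X) {q : Cube D X} (hq : q ∈ EF T D) (ε) : q ε ∈ E1 T :=
  EG_comp T (EF_sub_EG T hq) ε

lemma EF_empty (T : X ≃ₜ X) {q : Cube D X} (hq : q ∈ EF T D) : q ∅ = 1 := by
  have hc : IsClosed {q : Cube D X | q ∅ = 1} := isClosed_eq (continuous_apply ∅) continuous_const
  refine closure_minimal ?_ hc hq
  rintro _ ⟨n, rfl⟩
  simp [FF, tau_zero]

def face (i : Fin D) (g : Function.End X) : Cube D X := fun ε => if i ∈ ε then g else 1

lemma face_mem (T : X ≃ₜ X) (i : Fin D) {g : Function.End X} (hg : g ∈ E1 T) :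
    face i g ∈ EF T D := by
  have hc : Continuous (face (X := X) i) := by
    refine continuous_pi fun ε => ?_
    by_cases h : i ∈ ε
    · simp only [face, h, if_true]; exact continuous_id
    · simp only [face, h, if_false]; exact continuous_const
  refine map_mem_closure hc hg ?_
  rintro _ ⟨n, rfl⟩
  refine ⟨Pi.single i n, ?_⟩
  funext ε
  have hs : ∑ j ∈ ε, (Pi.single i n : Fin D → ℤ) j = if i ∈ ε then n else 0 := by
    simp [Pi.single_apply]
  simp only [FF, face, hs]
  split_ifs
  · rfl
  · exact tau_zero T

lemma diag_mem (T : X ≃ₜ X) {g : Function.End X} (hg : g ∈ E1 T) :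
    (fun _ => g : Cube D X) ∈ EG T D := by
  refine map_mem_closure (f := fun g => (fun _ => g : Cube D X))
    (continuous_pi fun ε => continuous_id) hg ?_
  rintro _ ⟨n, rfl⟩
  exact ⟨(n, 0), by funext ε; simp [GG]⟩

def RR (S : Finset (Fin D)) (q : Cube D X) : Cube D X := fun ε => q (ε ∩ S)

lemma RR_cont (S : Finset (Fin D)) : Continuous (RR (X := X) S) :=
  continuous_pi fun ε => continuous_apply (ε ∩ S)

lemma sum_RR (S ε : Finset (Fin D)) (n : Fin D → ℤ) :
    ∑ i ∈ ε, (if i ∈ S then n i else 0) = ∑ i ∈ ε ∩ S, n i := by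
  rw [← Finset.sum_filter, Finset.filter_mem_eq_inter]

lemma RR_EF (T : X ≃ₜ X) (S : Finset (Fin D)) {q : Cube D X} (hq : q ∈ EF T D) :
    RR S q ∈ EF T D := by
  refine map_mem_closure (RR_cont S) hq ?_
  rintro _ ⟨n, rfl⟩
  refine ⟨fun i => if i ∈ S then n i else 0, ?_⟩
  funext ε
  simp only [FF, RR, sum_RR]

lemma RR_EG (T : X ≃ₜ X) (S : Finset (Fin D)) {q : Cube D X} (hq : q ∈ EG T D) :
    RR S q ∈ EG T D := by
  refine map_mem_closure (RR_cont S) hq ?_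
  rintro _ ⟨⟨m, n⟩, rfl⟩
  refine ⟨(m, fun i => if i ∈ S then n i else 0), ?_⟩
  funext ε
  simp only [GG, RR, sum_RR]

def refl (l : Fin D) (ε : Finset (Fin D)) : Finset (Fin D) :=
  if l ∈ ε then ε.erase l else insert l ε

lemma refl_EG (T : X ≃ₜ X) (l : Fin D) {q : Cube D X} (hq : q ∈ EG T D) :
    (fun ε => q (refl l ε)) ∈ EG T D := by
  refine map_mem_closure (f := fun q : Cube D X => fun ε => q (refl l ε))
    (continuous_pi fun ε => continuous_apply _) hq ?_
  rintro _ ⟨⟨m, n⟩, rfl⟩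
  refine ⟨(m + n l, Function.update n l (- n l)), ?_⟩
  funext ε
  simp only [GG, refl]
  congr 1
  split_ifs with h
  · rw [← Finset.add_sum_erase _ _ h, Function.update_self]
    rw [Finset.sum_congr rfl (g := n)]
    · ring
    · intro i hi; exact Function.update_of_ne (Finset.ne_of_mem_erase hi) _ _
  · rw [Finset.sum_insert h, Finset.sum_congr rfl (g := n)]
    · ring
    · intro i hi; refine Function.update_of_ne ?_ _ _
      rintro rfl; exact h hi

end enveloping

section uprop

variable {X : Type} [MetricSpace X] [CompactSpace X] {D : ℕ}

def vst (D : ℕ) (v : Function.End X) : Cube D X := fun ε => if ε.Nonempty then v else 1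

lemma vst_ne (v : Function.End X) {ε : Finset (Fin D)} (h : ε.Nonempty) : vst D v ε = v := by
  simp [vst, h]

lemma vst_mem (T : X ≃ₜ X) {v : Function.End X} (hv : v ∈ E1 T) (hvv : v * v = v) :
    vst D v ∈ EF T D := by
  have key : ∀ S : Finset (Fin D),
      (fun ε => if (ε ∩ S).Nonempty then v else 1 : Cube D X) ∈ EF T D := by
    intro S
    induction S using Finset.induction_on with
    | empty =>
      simp only [Finset.inter_empty, Finset.not_nonempty_empty, if_false]
      exact EF_one T
    | insert i S hi ih =>
      convert EF_mul T (face_mem T i hv) ih using 1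
      funext ε
      simp only [face, Pi.mul_apply]
      by_cases h1 : i ∈ ε
      · have h2 : (ε ∩ insert i S).Nonempty := ⟨i, by simp [h1]⟩
        rw [if_pos h2, if_pos h1]
        split_ifs <;> simp [hvv]
      · rw [Finset.inter_insert_of_notMem h1, if_neg h1, one_mul]
  have := key Finset.univ
  simp only [Finset.inter_univ] at this
  exact this

/-- Left division. -/
lemma P2 (T : X ≃ₜ X) {M : Set (Function.End X)} (hM : MinId (E1 T) M) {v : Function.End X}
    (hv : v ∈ M) (hvv : v * v = v) {f : Cube D X} (hf : f ∈ EF T D) :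
    ∃ f' ∈ EF T D, f' * f * vst D v = vst D v := by
  have hvs := vst_mem (D := D) T (hM.sub hv) hvv
  obtain ⟨w, ⟨g, hg, hgw⟩, hww⟩ := exists_idempotent_in_compact_subsemigroup
    (fun r : Cube D X => cube_right r) ((fun g => g * (f * vst D v)) '' EF T D)
    ⟨_, 1, EF_one T, rfl⟩
    (isClosed_closure.isCompact.image (cube_right _))
    (by
      rintro _ ⟨a, ha, rfl⟩ _ ⟨b, hb, rfl⟩
      refine ⟨a * (f * vst D v) * b, EF_mul T (EF_mul T ha (EF_mul T hf hvs)) hb, ?_⟩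
      simp only [mul_assoc])
  have hwF : w ∈ EF T D := hgw ▸ EF_mul T hg (EF_mul T hf hvs)
  refine ⟨vst D v * g, EF_mul T hvs hg, ?_⟩
  have : vst D v * g * f * vst D v = vst D v * w := by rw [← hgw]; simp only [mul_assoc]
  rw [this]
  funext ε
  rcases ε.eq_empty_or_nonempty with rfl | hne
  · rw [Pi.mul_apply, EF_empty T hwF, mul_one]
  · rw [Pi.mul_apply, vst_ne v hne]
    refine hM.idem_right ?_ (congrFun hww ε) hv
    rw [← hgw]
    simp only [Pi.mul_apply, vst_ne v hne]
    exact hM.ideal _ (EF_comp T hg ε) _ (hM.ideal _ (EF_comp T hf ε) _ hv)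

lemma cube_apply_cont (x : X) : Continuous (fun q : Cube D X => fun ε => q ε x) :=
  continuous_pi fun ε => (end_apply_cont x).comp (continuous_apply ε)

lemma P3 (T : X ≃ₜ X) [Nonempty X] : ∃ x₀ : X, ∀ q ∈ EG T D, ∀ x', q ∅ x' = x₀ →
    ∃ f ∈ EF T D, ∀ ε, f ε x₀ = q ε x' := by
  let B := TopologicalSpace.countableBasis (Finset (Fin D) → X)
  have hB := TopologicalSpace.isBasis_countableBasis (Finset (Fin D) → X)
  have hBc := TopologicalSpace.countable_countableBasis (Finset (Fin D) → X)
  let DO : Set (Finset (Fin D) → X) → Set X := fun O =>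
    ⋃ n : Fin D → ℤ, {x | (fun ε => FF T n ε x) ∈ O}
  have hDO : ∀ O ∈ B, IsOpen (DO O) := by
    intro O hO
    refine isOpen_iUnion fun n => (hB.isOpen hO).preimage ?_
    exact continuous_pi fun ε => tau_cont T _
  have hd : Dense (⋂ O ∈ B, (frontier (DO O))ᶜ) := by
    refine dense_biInter_of_isOpen (fun O hO => isClosed_frontier.isOpen_compl) hBc ?_
    intro O hO
    rw [← interior_eq_empty_iff_dense_compl, ← frontier_compl]
    exact interior_frontier (hDO O hO).isClosed_compl
  obtain ⟨x₀, hx₀⟩ := hd.nonempty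
  refine ⟨x₀, fun q hq x' hqx => ?_⟩
  have hz : (fun ε => q ε x') ∈ closure (Set.range fun n : Fin D → ℤ => fun ε => FF T n ε x₀) := by
    rw [hB.mem_closure_iff]
    intro O hO hzO
    have hcl : x₀ ∈ closure (DO O) := by
      rw [mem_closure_iff]
      intro W hW hxW
      have hop : IsOpen {r : Cube D X | r ∅ x' ∈ W ∧ (fun ε => r ε x') ∈ O} := by
        refine IsOpen.and (hW.preimage ((end_apply_cont x').comp (continuous_apply ∅))) ?_
        exact (hB.isOpen hO).preimage (cube_apply_cont x')
      obtain ⟨_, ⟨h1, h2⟩, ⟨⟨m, n⟩, rfl⟩⟩ := mem_closure_iff.1 hq _ hop ⟨by rw [hqx]; exact hxW, hzO⟩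
      refine ⟨tau T m x', ?_, Set.mem_iUnion.2 ⟨n, ?_⟩⟩
      · simpa [GG] using h1
      · have he : (fun ε => FF T n ε (tau T m x')) = fun ε => GG T m n ε x' := by
          funext ε
          simp only [FF, GG]
          rw [add_comm, tau_add]; rfl
        change (fun ε => FF T n ε (tau T m x')) ∈ O
        rw [he]; exact h2
    have hx := Set.mem_iInter₂.1 hx₀ O hO
    rw [(hDO O hO).frontier_eq] at hx
    have hmem : x₀ ∈ DO O := by
      by_contra hcon; exact hx ⟨hcl, hcon⟩
    obtain ⟨n, hn⟩ := Set.mem_iUnion.1 hmem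
    exact ⟨_, hn, ⟨n, rfl⟩⟩
  have hsub : closure (Set.range fun n : Fin D → ℤ => fun ε => FF T n ε x₀) ⊆
      (fun q : Cube D X => fun ε => q ε x₀) '' EF T D := by
    refine closure_minimal ?_ (isClosed_closure.isCompact.image (cube_apply_cont x₀)).isClosed
    rintro _ ⟨n, rfl⟩
    exact ⟨_, EF_FF T n, rfl⟩
  obtain ⟨f, hf, h⟩ := hsub hz
  exact ⟨f, hf, fun ε => congrFun h ε⟩

def UU (T : X ≃ₜ X) (D : ℕ) (x : X) : Prop := ∀ q ∈ EG T D, ∀ x', q ∅ x' = x →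
  ∃ f ∈ EF T D, ∀ ε, f ε (q ε x') = x

lemma U_base (T : X ≃ₜ X) (hmin : MinimalTDS T) {M : Set (Function.End X)}
    (hM : MinId (E1 T) M) [Nonempty X] : ∃ x₀, UU T D x₀ := by
  obtain ⟨x₀, h⟩ := P3 (D := D) T
  refine ⟨x₀, fun q hq x' hqx => ?_⟩
  obtain ⟨f, hf, hfq⟩ := h q hq x' hqx
  obtain ⟨v, hv, hvv, hvx⟩ := exists_idem T hmin hM x₀
  obtain ⟨f', hf', he⟩ := P2 T hM hv hvv hf
  have hx : ∀ ε, vst D v ε x₀ = x₀ := by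
    intro ε; simp only [vst]; split_ifs
    · exact hvx
    · rfl
  refine ⟨f', hf', fun ε => ?_⟩
  rw [← hfq ε]
  have := congrFun (congrFun he ε) x₀
  rw [hx ε] at this
  change f' ε (f ε (vst D v ε x₀)) = x₀ at this
  rwa [hx ε] at this

lemma U_move (T : X ≃ₜ X) (hmin : MinimalTDS T) {M : Set (Function.End X)}
    (hM : MinId (E1 T) M) {x₀ : X} (h : UU T D x₀) {v : Function.End X}
    (hv : v ∈ M) (hvv : v * v = v) : UU T D (v x₀) := by
  intro q hq x' hqx
  obtain ⟨w, hw, hww, hwx⟩ := exists_idem T hmin hM x₀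
  have hwv : w * v = w := hM.idem_right hv hvv hw
  obtain ⟨f, hf, hfq⟩ := h ((fun _ => w) * q) (EG_mul T (diag_mem T (hM.sub hw)) hq) x' (by
    change w (q ∅ x') = x₀
    rw [hqx]
    have := congrFun hwv x₀
    change w (v x₀) = w x₀ at this
    rw [this, hwx])
  refine ⟨vst D v * f * vst D w, EF_mul T (EF_mul T (vst_mem T (hM.sub hv) hvv) hf)
    (vst_mem T (hM.sub hw) hww), fun ε => ?_⟩
  rcases ε.eq_empty_or_nonempty with rfl | hne
  · have h1 : (vst D v * f * vst D w) ∅ = 1 := EF_empty T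
      (EF_mul T (EF_mul T (vst_mem T (hM.sub hv) hvv) hf) (vst_mem T (hM.sub hw) hww))
    rw [h1]; exact hqx
  · rw [Pi.mul_apply, Pi.mul_apply, vst_ne v hne, vst_ne w hne]
    exact congrArg v (hfq ε)

/-! ### the group -/

def Gam (M : Set (Function.End X)) (v : Function.End X) : Type :=
  {p : Function.End X // p ∈ M ∧ v * p = p}

lemma Gam.exists_inv (T : X ≃ₜ X) {M : Set (Function.End X)} (hM : MinId (E1 T) M)
    {v : Function.End X} (hv : v ∈ M) (hvv : v * v = v) (p : Gam M v) :
    ∃ r : Gam M v, r.1 * p.1 = v := by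
  obtain ⟨e, he, hep⟩ := hM.tr p.1 p.2.1 v hv
  refine ⟨⟨v * e * v, hM.ideal _ (E1_mul T (hM.sub hv) he) _ hv, ?_⟩, ?_⟩
  · rw [← mul_assoc, ← mul_assoc, hvv]
  · change v * e * v * p.1 = v
    rw [mul_assoc, p.2.2, mul_assoc, hep, hvv]

@[reducible] noncomputable def Gam.group (T : X ≃ₜ X) {M : Set (Function.End X)} (hM : MinId (E1 T) M)
    {v : Function.End X} (hv : v ∈ M) (hvv : v * v = v) : Group (Gam M v) :=
  letI : Mul (Gam M v) := ⟨fun a b => ⟨a.1 * b.1, hM.ideal _ (hM.sub a.2.1) _ b.2.1, by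
    rw [← mul_assoc, a.2.2]⟩⟩
  letI : One (Gam M v) := ⟨⟨v, hv, hvv⟩⟩
  letI : Inv (Gam M v) := ⟨fun p => (Gam.exists_inv T hM hv hvv p).choose⟩
  Group.ofLeftAxioms (fun a b c => Subtype.ext (mul_assoc a.1 b.1 c.1))
    (fun a => Subtype.ext a.2.2)
    (fun a => Subtype.ext (Gam.exists_inv T hM hv hvv a).choose_spec)

noncomputable def KK (T : X ≃ₜ X) {M : Set (Function.End X)} (hM : MinId (E1 T) M)
    {v : Function.End X} (hv : v ∈ M) (hvv : v * v = v) (D : ℕ) :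
    letI := Gam.group T hM hv hvv
    Subgroup (Finset (Fin D) → Gam M v) :=
  letI := Gam.group T hM hv hvv
  { carrier := {k | k ∅ = 1 ∧ ∃ f ∈ EF T D, ∀ ε : Finset (Fin D), ε.Nonempty → f ε * v = (k ε).1}
    one_mem' := ⟨rfl, vst D v, vst_mem T (hM.sub hv) hvv, fun ε h => by
      rw [vst_ne v h, hvv]; rfl⟩
    mul_mem' := by
      rintro a b ⟨ha, f, hf, hfa⟩ ⟨hb, g, hg, hgb⟩
      refine ⟨by rw [Pi.mul_apply, ha, hb, one_mul], f * g, EF_mul T hf hg, fun ε h => ?_⟩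
      change f ε * g ε * v = (a ε).1 * (b ε).1
      rw [← hfa ε h, mul_assoc, hgb ε h, mul_assoc, (b ε).2.2]
    inv_mem' := by
      rintro a ⟨ha, f, hf, hfa⟩
      refine ⟨by rw [Pi.inv_apply, ha, inv_one], ?_⟩
      obtain ⟨f', hf', h⟩ := P2 T hM hv hvv hf
      refine ⟨vst D v * f', EF_mul T (vst_mem T (hM.sub hv) hvv) hf', fun ε hε => ?_⟩
      have h1 : f' ε * (f ε * v) = v := by
        have := congrFun h ε
        simpa only [Pi.mul_apply, vst_ne v hε, mul_assoc] using this
      rw [hfa ε hε] at h1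
      let r : Gam M v := ⟨v * f' ε * v, hM.ideal _ (E1_mul T (hM.sub hv) (EF_comp T hf' ε)) _ hv, by
        rw [← mul_assoc, ← mul_assoc, hvv]⟩
      have h2 : r * a ε = 1 := by
        refine Subtype.ext ?_
        change v * f' ε * v * (a ε).1 = v
        rw [mul_assoc, (a ε).2.2, mul_assoc, h1, hvv]
      have h3 : (a ε)⁻¹ = r := inv_eq_of_mul_eq_one_left h2
      rw [Pi.inv_apply, h3, Pi.mul_apply, vst_ne v hε] }

lemma KK_RR (T : X ≃ₜ X) {M : Set (Function.End X)} (hM : MinId (E1 T) M)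
    {v : Function.End X} (hv : v ∈ M) (hvv : v * v = v) (S : Finset (Fin D))
    {k : Finset (Fin D) → Gam M v} (hk : k ∈ KK T hM hv hvv D) :
    (fun ε => k (ε ∩ S)) ∈ KK T hM hv hvv D := by
  obtain ⟨h0, f, hf, hfk⟩ := hk
  refine ⟨by simpa using h0, vst D v * RR S f, EF_mul T (vst_mem T (hM.sub hv) hvv) (RR_EF T S hf),
    fun ε hε => ?_⟩
  rw [Pi.mul_apply, vst_ne v hε, mul_assoc]
  simp only [RR]
  rcases (ε ∩ S).eq_empty_or_nonempty with he | hne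
  · rw [he, EF_empty T hf, h0, one_mul, hvv]; rfl
  · rw [hfk _ hne, (k (ε ∩ S)).2.2]

lemma KK_face (T : X ≃ₜ X) {M : Set (Function.End X)} (hM : MinId (E1 T) M)
    {v : Function.End X} (hv : v ∈ M) (hvv : v * v = v) (i : Fin D) (g : Gam M v) :
    letI := Gam.group T hM hv hvv
    (fun ε => if i ∈ ε then g else 1) ∈ KK T hM hv hvv D := by
  letI := Gam.group T hM hv hvv
  refine ⟨by simp, vst D v * face i g.1, EF_mul T (vst_mem T (hM.sub hv) hvv)
    (face_mem T i (hM.sub g.2.1)), fun ε hε => ?_⟩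
  rw [Pi.mul_apply, vst_ne v hε]
  simp only [face]
  split_ifs with h
  · rw [g.2.2]; exact hM.idem_right hv hvv g.2.1
  · rw [mul_one, hvv]; rfl

lemma KK_conj (T : X ≃ₜ X) {M : Set (Function.End X)} (hM : MinId (E1 T) M)
    {v : Function.End X} (hv : v ∈ M) (hvv : v * v = v)
    {k : Finset (Fin D) → Gam M v} (hk : k ∈ KK T hM hv hvv D) (g : Gam M v) :
    letI := Gam.group T hM hv hvv
    (fun ε => g * k ε * g⁻¹) ∈ KK T hM hv hvv D := by
  letI := Gam.group T hM hv hvv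
  have key : ∀ S : Finset (Fin D),
      (fun ε => g * k (ε ∩ S) * g⁻¹ * (k (ε ∩ S))⁻¹) ∈ KK T hM hv hvv D := by
    intro S
    induction S using Finset.induction_on with
    | empty =>
      convert (KK T hM hv hvv D).one_mem using 1
      funext ε
      have : k ∅ = 1 := hk.1
      simp [this]
    | insert i S hi ih =>
      have hg := KK_face T hM hv hvv i g
      have h1 := KK_RR T hM hv hvv (insert i S) hk
      have h2 := KK_RR T hM hv hvv S hk
      have hc1 := (KK T hM hv hvv D).mul_mem ((KK T hM hv hvv D).mul_mem
        ((KK T hM hv hvv D).mul_mem hg h1) ((KK T hM hv hvv D).inv_mem hg))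
        ((KK T hM hv hvv D).inv_mem h1)
      have hc2 := (KK T hM hv hvv D).mul_mem ((KK T hM hv hvv D).mul_mem
        ((KK T hM hv hvv D).mul_mem hg h2) ((KK T hM hv hvv D).inv_mem hg))
        ((KK T hM hv hvv D).inv_mem h2)
      convert (KK T hM hv hvv D).mul_mem ((KK T hM hv hvv D).mul_mem hc1 ih)
        ((KK T hM hv hvv D).inv_mem hc2) using 1
      funext ε
      simp only [Pi.mul_apply, Pi.inv_apply]
      by_cases h : i ∈ ε
      · simp only [h, if_true]; group
      · simp only [h, if_false, Finset.inter_insert_of_notMem h]; group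
  have := (KK T hM hv hvv D).mul_mem (key Finset.univ) hk
  convert this using 1
  funext ε
  simp

lemma U_same (T : X ≃ₜ X) (hmin : MinimalTDS T) {M : Set (Function.End X)}
    (hM : MinId (E1 T) M) {v : Function.End X} (hv : v ∈ M) (hvv : v * v = v)
    {x₁ x : X} (h : UU T D x₁) (h1 : v x₁ = x₁) (hx : v x = x) : UU T D x := by
  letI := Gam.group T hM hv hvv
  have hone : (1 : Gam M v).1 = v := rfl
  have hmul : ∀ a b : Gam M v, (a * b).1 = a.1 * b.1 := fun a b => rfl
  intro q hq x' hqx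
  obtain ⟨e, he, hex⟩ := E1_orbit T hmin x x₁
  let g : Gam M v := ⟨v * e * v, hM.ideal _ (E1_mul T (hM.sub hv) he) _ hv, by
    rw [← mul_assoc, ← mul_assoc, hvv]⟩
  have hgx : g.1 x = x₁ := by
    change v (e (v x)) = x₁
    rw [hx, hex, h1]
  have hgx' : (g⁻¹).1 x₁ = x := by
    have : (g⁻¹).1 * g.1 = v := congrArg Subtype.val (inv_mul_cancel g)
    have := congrFun this x
    change (g⁻¹).1 (g.1 x) = v x at this
    rwa [hgx, hx] at this
  obtain ⟨f, hf, hfq⟩ := h ((fun _ => g.1) * q) (EG_mul T (diag_mem T (hM.sub g.2.1)) hq) x'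
    (by change g.1 (q ∅ x') = x₁; rw [hqx, hgx])
  let k : Finset (Fin D) → Gam M v := fun ε => if ε.Nonempty then
    ⟨v * f ε * v, hM.ideal _ (E1_mul T (hM.sub hv) (EF_comp T hf ε)) _ hv, by
      rw [← mul_assoc, ← mul_assoc, hvv]⟩ else 1
  have hkne : ∀ ε : Finset (Fin D), ε.Nonempty → (k ε).1 = v * f ε * v := by
    intro ε hε; exact congrArg Subtype.val (if_pos hε)
  have hk : k ∈ KK T hM hv hvv D := by
    refine ⟨by simp [k], vst D v * f, EF_mul T (vst_mem T (hM.sub hv) hvv) hf, fun ε hε => ?_⟩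
    rw [hkne ε hε, Pi.mul_apply, vst_ne v hε]
  obtain ⟨-, f', hf', hf'k⟩ := KK_conj T hM hv hvv hk g⁻¹
  have hvs := vst_mem (D := D) T (hM.sub hv) hvv
  refine ⟨f' * vst D v, EF_mul T hf' hvs, fun ε => ?_⟩
  rcases ε.eq_empty_or_nonempty with rfl | hne
  · rw [EF_empty T (EF_mul T hf' hvs)]; exact hqx
  · rw [Pi.mul_apply, vst_ne v hne, hf'k ε hne]
    simp only [inv_inv, hmul]
    change (g⁻¹).1 ((k ε).1 (g.1 (q ε x'))) = x
    rw [hkne ε hne]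
    change (g⁻¹).1 (v (f ε ((v * g.1) (q ε x')))) = x
    rw [g.2.2]
    have := hfq ε
    change f ε (g.1 (q ε x')) = x₁ at this
    rw [this, h1, hgx']

lemma U_all (T : X ≃ₜ X) (hmin : MinimalTDS T) (x : X) : UU T D x := by
  haveI : Nonempty X := ⟨x⟩
  obtain ⟨M, hM⟩ := exists_minId (end_right (X := X)) (E1 T) isClosed_closure (E1_one T)
    (fun a ha b hb => E1_mul T ha hb)
  obtain ⟨x₀, h₀⟩ := U_base (D := D) T hmin hM
  obtain ⟨v, hv, hvv, hvx⟩ := exists_idem T hmin hM x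
  refine U_same T hmin hM hv hvv (U_move T hmin hM h₀ hv hvv) ?_ hvx
  exact congrFun hvv x₀

end uprop

section forward

variable {X : Type} [MetricSpace X] [CompactSpace X] {d : ℕ}

lemma P5a (T : X ≃ₜ X) (hmin : MinimalTDS T) {x y : X} (h : RPd T d x y) :
    ∃ q ∈ EG T (d + 1), q ∅ x = x ∧ q {Fin.last d} x = y ∧
      ∀ ε : Finset (Fin (d + 1)), ε.Nonempty → ε ≠ {Fin.last d} →
        q ε x = q (insert (Fin.last d) ε) x := by
  let A : Cube (d + 1) X → (Finset (Fin (d + 1)) → X) := fun q ε => q ε x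
  let B : Cube (d + 1) X → (Finset (Fin (d + 1)) → X) := fun q ε =>
    if ε = ∅ then x else if ε = {Fin.last d} then y else q (insert (Fin.last d) ε) x
  have hA : Continuous A := cube_apply_cont x
  have hB : Continuous B := by
    refine continuous_pi fun ε => ?_
    simp only [B]
    split_ifs
    · exact continuous_const
    · exact continuous_const
    · exact (end_apply_cont x).comp (continuous_apply _)
  have happ : ∀ δ > 0, ∃ q ∈ EG T (d + 1), dist (A q) (B q) < δ := by
    intro δ hδ
    obtain ⟨x', y', n, hx, hy, hn⟩ := h δ hδ
    let W : Set (X × X) := {z | dist x z.1 < δ ∧ dist y z.2 < δ ∧ ∀ ε : Finset (Fin d), ε.Nonempty →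
      dist (hIter T (∑ i ∈ ε, n i) z.1) (hIter T (∑ i ∈ ε, n i) z.2) < δ}
    have hW : IsOpen W := by
      refine IsOpen.and ?_ (IsOpen.and ?_ ?_)
      · exact isOpen_lt (continuous_const.dist continuous_fst) continuous_const
      · exact isOpen_lt (continuous_const.dist continuous_snd) continuous_const
      · simp only [Set.setOf_forall]
        refine isOpen_iInter_of_finite fun ε => isOpen_iInter_of_finite fun _ => ?_
        exact isOpen_lt (((hIter_cont T _).comp continuous_fst).dist
          ((hIter_cont T _).comp continuous_snd)) continuous_const
    obtain ⟨⟨_, _⟩, hzW, ⟨⟨m, rfl⟩, ⟨m', rfl⟩⟩⟩ := ((hmin x).prod (hmin x)).inter_open_nonempty W hW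
      ⟨(x', y'), hx, hy, hn⟩
    obtain ⟨h1, h2, h3⟩ := hzW
    let N : Fin (d + 1) → ℤ := Fin.snoc n (m' - m)
    have hNl : N (Fin.last d) = m' - m := by simp [N]
    refine ⟨GG T m N, subset_closure ⟨(m, N), rfl⟩, ?_⟩
    rw [dist_pi_lt_iff hδ]
    intro ε
    simp only [A, B, GG]
    split_ifs with e1 e2
    · subst e1
      rw [dist_comm, Finset.sum_empty, add_zero]; exact h1
    · subst e2
      rw [dist_comm]
      simp only [Finset.sum_singleton, hNl, add_sub_cancel]
      exact h2
    · by_cases hl : Fin.last d ∈ ε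
      · rw [Finset.insert_eq_of_mem hl, dist_self]; exact hδ
      · obtain ⟨ε₁, rfl⟩ : ∃ ε₁ : Finset (Fin d), ε = ε₁.map Fin.castSuccEmb := by
          refine ⟨Finset.univ.filter (fun i => i.castSucc ∈ ε), ?_⟩
          ext i
          induction i using Fin.lastCases with
          | last => simp [hl]
          | cast i => simp
        have hs : ∑ i ∈ ε₁.map Fin.castSuccEmb, N i = ∑ i ∈ ε₁, n i := by
          rw [Finset.sum_map]; simp [N]
        have hne : ε₁.Nonempty := by
          rw [Finset.nonempty_iff_ne_empty]; rintro rfl; simp at e1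
        rw [Finset.sum_insert hl, hs, hNl]
        have := h3 ε₁ hne
        rw [← hIter_add, ← hIter_add] at this
        have k1 : m + ∑ i ∈ ε₁, n i = ∑ i ∈ ε₁, n i + m := by ring
        have k2 : m + (m' - m + ∑ i ∈ ε₁, n i) = ∑ i ∈ ε₁, n i + m' := by ring
        rw [k1, k2]
        exact this
  obtain ⟨q, hq, hmn⟩ := (isClosed_closure.isCompact (s := EG T (d + 1))).exists_isMinOn
    (by obtain ⟨q, hq, -⟩ := happ 1 one_pos; exact ⟨q, hq⟩) (hA.dist hB).continuousOn
  have h0 : dist (A q) (B q) = 0 := by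
    refine le_antisymm (le_of_forall_gt_imp_ge_of_dense ?_) dist_nonneg
    intro δ hδ
    obtain ⟨r, hr, hrd⟩ := happ δ hδ
    exact (hmn hr).trans hrd.le
  have heq : ∀ ε, A q ε = B q ε := fun ε => congrFun (dist_eq_zero.1 h0) ε
  refine ⟨q, hq, ?_, ?_, ?_⟩
  · simpa [A, B] using heq ∅
  · simpa [A, B] using heq {Fin.last d}
  · intro ε h1 h2
    have := heq ε
    simp only [A, B] at this
    rwa [if_neg h1.ne_empty, if_neg h2] at this

lemma P5 (T : X ≃ₜ X) (hmin : MinimalTDS T) {x y : X} (h : RPd T d x y) :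
    ∃ f ∈ EF T (d + 1), ∀ ε : Finset (Fin (d + 1)), ε.Nonempty → f ε x = y := by
  obtain ⟨q, hq, q0, q1, q2⟩ := P5a T hmin h
  set l := Fin.last d with hl
  have hS : ∀ ε : Finset (Fin (d + 1)), ε ∩ (Finset.univ.erase l) = ε.erase l := by
    intro ε; ext i; simp [and_comm]
  obtain ⟨f, hf, hfq⟩ := U_all T hmin x _ (RR_EG T (Finset.univ.erase l) hq) x (by simpa [RR] using q0)
  have hr : RR (Finset.univ.erase l) f * q ∈ EG T (d + 1) :=
    EG_mul T (EF_sub_EG T (RR_EF T _ hf)) hq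
  set r := RR (Finset.univ.erase l) f * q with hrdef
  have hr1 : r {l} x = y := by
    change f ({l} ∩ (Finset.univ.erase l)) (q {l} x) = y
    rw [hS, q1, Finset.erase_singleton, EF_empty T hf]; rfl
  have hr2 : ∀ ε, ε ≠ {l} → r ε x = x := by
    intro ε hε
    change f (ε ∩ (Finset.univ.erase l)) (q ε x) = x
    rw [hS]
    rcases ε.eq_empty_or_nonempty with rfl | hne
    · rw [q0, Finset.erase_empty, EF_empty T hf]; rfl
    have hne' : (ε.erase l).Nonempty := by
      rw [Finset.nonempty_iff_ne_empty]
      intro h0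
      rw [Finset.erase_eq_empty_iff] at h0
      rcases h0 with h0 | h0
      · exact hne.ne_empty h0
      · exact hε h0
    have hne2 : ε.erase l ≠ {l} := by
      intro h0
      have : l ∈ ε.erase l := by rw [h0]; simp
      simp at this
    have hqq : q ε x = q (ε.erase l) x := by
      by_cases hle : l ∈ ε
      · rw [q2 _ hne' hne2, Finset.insert_erase hle]
      · rw [Finset.erase_eq_of_notMem hle]
    rw [hqq]
    have := hfq (ε.erase l)
    simp only [RR, hS, Finset.erase_idem] at this
    exact this
  obtain ⟨f2, hf2, h2⟩ := U_all T hmin y _ (refl_EG T l hr) x (by simpa [refl] using hr1)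
  refine ⟨f2, hf2, fun ε hε => ?_⟩
  have hne : refl l ε ≠ {l} → f2 ε x = y := by
    intro h3
    have h4 : f2 ε (r (refl l ε) x) = y := h2 ε
    rwa [hr2 _ h3] at h4
  apply hne
  simp only [refl]
  split_ifs with h3
  · intro h0
    have : l ∈ ε.erase l := by rw [h0]; simp
    simp at this
  · intro h0
    obtain ⟨i, hi⟩ := hε
    have : i ∈ insert l ε := Finset.mem_insert_of_mem hi
    rw [h0, Finset.mem_singleton] at this
    exact h3 (this ▸ hi)

lemma lemC (T : X ≃ₜ X) (hmin : MinimalTDS T) {x y : X} (h : RPd T d x y)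
    (n : Fin (d + 1) → ℤ) (O : Finset (Fin (d + 1)) → Set X) (hO : ∀ ε, IsOpen (O ε))
    (hn : ∀ ε : Finset (Fin (d + 1)), ε.Nonempty → Fin.last d ∉ ε →
      hIter T (∑ i ∈ ε, n i) x ∈ O ε)
    (U : Set X) (hU : IsOpen U) (hy : y ∈ U) :
    ∃ m : Fin (d + 1) → ℤ, hIter T (m (Fin.last d)) x ∈ U ∧
      ∀ ε : Finset (Fin (d + 1)), ε.Nonempty → Fin.last d ∉ ε →
        hIter T (∑ i ∈ ε, m i) x ∈ O ε ∧ hIter T (∑ i ∈ insert (Fin.last d) ε, m i) x ∈ O ε := by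
  obtain ⟨f, hf, hfx⟩ := P5 T hmin h
  set l := Fin.last d with hl
  have hS : ∀ ε : Finset (Fin (d + 1)), ε ∩ (Finset.univ.erase l) = ε.erase l := by
    intro ε; ext i; simp [and_comm]
  obtain ⟨M, hM⟩ := exists_minId (end_right (X := X)) (E1 T) isClosed_closure (E1_one T)
    (fun a ha b hb => E1_mul T ha hb)
  obtain ⟨v, hv, hvv, hvx⟩ := exists_idem T hmin hM x
  obtain ⟨f', hf', he⟩ := P2 T hM hv hvv hf
  have hf'y : ∀ ε : Finset (Fin (d + 1)), ε.Nonempty → f' ε y = x := by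
    intro ε hε
    have := congrFun (congrFun he ε) x
    rw [Pi.mul_apply, Pi.mul_apply, vst_ne v hε, hvx] at this
    change f' ε (f ε (v x)) = x at this
    rwa [hvx, hfx ε hε] at this
  have hh : RR (Finset.univ.erase l) (FF T n * f') * f ∈ EF T (d + 1) :=
    EF_mul T (RR_EF T _ (EF_mul T (EF_FF T n) hf')) hf
  have hval : ∀ ε : Finset (Fin (d + 1)), ε.Nonempty →
      (RR (Finset.univ.erase l) (FF T n * f') * f) ε x =
        hIter T (∑ i ∈ ε.erase l, n i) (f' (ε.erase l) y) := by
    intro ε hε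
    change FF T n (ε ∩ (Finset.univ.erase l)) (f' (ε ∩ (Finset.univ.erase l)) (f ε x)) = _
    rw [hS, hfx ε hε]; rfl
  let V : Set (Cube (d + 1) X) := {r | r {l} x ∈ U ∧
    ∀ ε : Finset (Fin (d + 1)), ε.Nonempty → l ∉ ε → r ε x ∈ O ε ∧ r (insert l ε) x ∈ O ε}
  have hc : ∀ ε, Continuous (fun r : Cube (d + 1) X => r ε x) := fun ε =>
    (end_apply_cont x).comp (continuous_apply ε)
  have hV : IsOpen V := by
    refine IsOpen.and (hU.preimage (hc _)) ?_
    simp only [Set.setOf_forall]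
    refine isOpen_iInter_of_finite fun ε => isOpen_iInter_of_finite fun _ =>
      isOpen_iInter_of_finite fun _ => ?_
    exact IsOpen.and ((hO ε).preimage (hc _)) ((hO ε).preimage (hc _))
  have hmem : RR (Finset.univ.erase l) (FF T n * f') * f ∈ V := by
    refine ⟨?_, fun ε hε hlε => ⟨?_, ?_⟩⟩
    · rw [hval _ (Finset.singleton_nonempty l), Finset.erase_singleton, EF_empty T hf',
        Finset.sum_empty, hIter_zero]
      exact hy
    · rw [hval ε hε, Finset.erase_eq_of_notMem hlε, hf'y ε hε]
      exact hn ε hε hlε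
    · rw [hval _ (Finset.insert_nonempty l ε), Finset.erase_insert hlε, hf'y ε hε]
      exact hn ε hε hlε
  obtain ⟨_, ⟨h1, h2⟩, ⟨m, rfl⟩⟩ := mem_closure_iff.1 hh V hV hmem
  refine ⟨m, ?_, h2⟩
  have h3 : hIter T (∑ i ∈ {l}, m i) x ∈ U := h1
  rwa [Finset.sum_singleton] at h3

def Good (T : X ≃ₜ X) (d : ℕ) (x : X) (U : Set X) (G : ℕ → Set X) : Prop :=
  (∀ j, IsOpen (G j)) ∧ (∀ j, G j ⊆ U) ∧ ∃ n : Fin (d + 1) → ℤ,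
    ∀ ε : Finset (Fin (d + 1)), ∀ i ∈ ε, (∀ j ∈ ε, i ≤ j) →
      hIter T (∑ j ∈ ε, n j) x ∈ G (d - i)

lemma good_init (T : X ≃ₜ X) (hmin : MinimalTDS T) {x y : X} (h : RPd T d x y)
    (U : Set X) (hU : IsOpen U) (hy : y ∈ U) : Good T d x U (fun _ => U) := by
  refine ⟨fun _ => hU, fun _ => subset_rfl, ?_⟩
  obtain ⟨f, hf, hfx⟩ := P5 T hmin h
  let V : Set (Cube (d + 1) X) := {r | ∀ ε : Finset (Fin (d + 1)), ε.Nonempty → r ε x ∈ U}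
  have hV : IsOpen V := by
    simp only [V, Set.setOf_forall]
    refine isOpen_iInter_of_finite fun ε => isOpen_iInter_of_finite fun _ => ?_
    exact hU.preimage ((end_apply_cont x).comp (continuous_apply ε))
  obtain ⟨_, h1, ⟨m, rfl⟩⟩ := mem_closure_iff.1 hf V hV
    (fun ε hε => by rw [hfx ε hε]; exact hy)
  exact ⟨m, fun ε i hi _ => h1 ε ⟨i, hi⟩⟩

lemma good_step (T : X ≃ₜ X) (hmin : MinimalTDS T) {x y : X} (h : RPd T d x y)
    (U : Set X) (hU : IsOpen U) (hy : y ∈ U) (G : ℕ → Set X) (hG : Good T d x U G) :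
    ∃ (p : ℤ) (G' : ℕ → Set X), Good T d x U G' ∧ (∀ j, G' (j + 1) ⊆ G j) ∧
      (∀ j, ∀ u ∈ G' (j + 1), hIter T p u ∈ G d) ∧ hIter T p x ∈ G d := by
  obtain ⟨hop, hsub, n, hn⟩ := hG
  let p := n 0
  let G' : ℕ → Set X := fun j => Nat.casesOn j U (fun j => G j ∩ hIter T p ⁻¹' (G d))
  have hG's : ∀ j, G' (j + 1) = G j ∩ hIter T p ⁻¹' (G d) := fun j => rfl
  have hG'o : ∀ j, IsOpen (G' j) := by
    intro j
    cases j with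
    | zero => exact hU
    | succ j => exact (hop j).inter ((hop d).preimage (hIter_cont T p))
  have hpx : hIter T p x ∈ G d := by
    have := hn {0} 0 (by simp) (by simp)
    simpa using this
  let O : Finset (Fin (d + 1)) → Set X := fun ε =>
    {z | ∀ i ∈ ε, (∀ j ∈ ε, i ≤ j) → z ∈ G' (d - i)}
  have hO : ∀ ε, IsOpen (O ε) := by
    intro ε
    simp only [O, Set.setOf_forall]
    refine isOpen_iInter_of_finite fun i => isOpen_iInter_of_finite fun _ =>
      isOpen_iInter_of_finite fun _ => hG'o _
  obtain ⟨m, hm1, hm2⟩ := lemC T hmin h (Fin.snoc (fun i : Fin d => n i.succ) 0) O hO (by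
    intro ε hε hl
    obtain ⟨ε₁, rfl⟩ : ∃ ε₁ : Finset (Fin d), ε = ε₁.map Fin.castSuccEmb := by
      refine ⟨Finset.univ.filter (fun i => i.castSucc ∈ ε), ?_⟩
      ext i
      induction i using Fin.lastCases with
      | last => simp [hl]
      | cast i => simp
    have hs : ∑ i ∈ ε₁.map Fin.castSuccEmb, (Fin.snoc (fun i : Fin d => n i.succ) 0 : Fin (d + 1) → ℤ) i
        = ∑ i ∈ ε₁.map (Fin.succEmb d), n i := by
      rw [Finset.sum_map, Finset.sum_map]; simp
    rw [hs]
    intro i hi hmini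
    rw [Finset.mem_map] at hi
    obtain ⟨i, hi, rfl⟩ := hi
    have hi' : ∀ j ∈ ε₁, i ≤ j := by
      intro j hj
      have := hmini j.castSucc (Finset.mem_map.2 ⟨j, hj, rfl⟩)
      simpa using this
    have e1 : d - ((Fin.castSuccEmb i : Fin (d + 1)) : ℕ) = (d - (i.succ : Fin (d + 1))) + 1 := by
      have := i.2
      simp; omega
    rw [e1, hG's]
    refine ⟨hn _ i.succ (Finset.mem_map.2 ⟨i, hi, rfl⟩) ?_, ?_⟩
    · intro j hj
      obtain ⟨j, hj', rfl⟩ := Finset.mem_map.1 hj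
      simpa using hi' j hj'
    · have h0 : (0 : Fin (d + 1)) ∉ ε₁.map (Fin.succEmb d) := by
        simp [Fin.succ_ne_zero]
      have := hn (insert 0 (ε₁.map (Fin.succEmb d))) 0 (by simp) (by simp)
      rw [Finset.sum_insert h0, hIter_add] at this
      simpa using this) U hU hy
  refine ⟨p, G', ⟨hG'o, ?_, m, ?_⟩, fun j => Set.inter_subset_left, fun j u hu => hu.2, hpx⟩
  · intro j
    cases j with
    | zero => exact subset_rfl
    | succ j => exact Set.inter_subset_left.trans (hsub j)
  · intro ε i hi hmini
    by_cases hl : Fin.last d ∈ ε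
    · rcases (ε.erase (Fin.last d)).eq_empty_or_nonempty with h0 | h0
      · have hε : ε = {Fin.last d} := by
          rcases (Finset.erase_eq_empty_iff _ _).1 h0 with h | h
          · subst h; simp at hi
          · exact h
        subst hε
        rw [Finset.mem_singleton] at hi
        subst hi
        simp only [Finset.sum_singleton, Fin.val_last, Nat.sub_self]
        exact hm1
      · have := (hm2 _ h0 (Finset.notMem_erase _ _)).2
        rw [Finset.insert_erase hl] at this
        refine this i ?_ (fun j hj => hmini j (Finset.mem_of_mem_erase hj))
        rw [Finset.mem_erase]
        refine ⟨?_, hi⟩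
        rintro rfl
        obtain ⟨j, hj⟩ := h0
        rw [Finset.mem_erase] at hj
        exact hj.1 (Fin.last_le_iff.1 (hmini j hj.2))
    · exact (hm2 ε ⟨i, hi⟩ hl).1 i hi hmini

lemma SG_of_RPd (T : X ≃ₜ X) (hmin : MinimalTDS T) {x y : X} (h : RPd T d x y)
    (U : Set X) (hU : IsOpen U) (hy : y ∈ U) : ∃ P : ℕ → ℤ, SG d P ⊆ Nset T x U := by
  have hstep := good_step T hmin h U hU hy
  choose p G' hG' hdesc hpu hpx using hstep
  let st : ℕ → {G : ℕ → Set X // Good T d x U G} := fun k =>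
    Nat.rec ⟨fun _ => U, good_init T hmin h U hU hy⟩ (fun _ s => ⟨G' s.1 s.2, hG' s.1 s.2⟩) k
  let P : ℕ → ℤ := fun k => p (st k).1 (st k).2
  have d1 : ∀ k j, (st (k + 1)).1 (j + 1) ⊆ (st k).1 j := fun k j => hdesc _ (st k).2 j
  have d2 : ∀ k j, ∀ u ∈ (st (k + 1)).1 (j + 1), hIter T (P k) u ∈ (st k).1 d :=
    fun k j => hpu _ (st k).2 j
  have d3 : ∀ k, hIter T (P k) x ∈ (st k).1 d := fun k => hpx _ (st k).2
  have d4 : ∀ r l j, r + 1 ≤ j → ∀ w ∈ (st (l + 1 + r)).1 j, hIter T (P l) w ∈ (st l).1 d := by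
    intro r
    induction r with
    | zero =>
      intro l j hj w hw
      obtain ⟨j, rfl⟩ : ∃ i, j = i + 1 := ⟨j - 1, by omega⟩
      exact d2 l j w hw
    | succ r ih =>
      intro l j hj w hw
      obtain ⟨j, rfl⟩ : ∃ i, j = i + 1 := ⟨j - 1, by omega⟩
      exact ih l j (by omega) w (d1 _ j hw)
  have key : ∀ k (i : Fin (k + 1) → ℕ), StrictMono i →
      (∀ t : Fin k, i t.succ - i t.castSucc ≤ d) → ∀ u,
      hIter T (P (i (Fin.last k))) u ∈ (st (i (Fin.last k))).1 d →
      hIter T (∑ t, P (i t)) u ∈ U := by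
    intro k
    induction k with
    | zero =>
      intro i _ _ u hu
      have := (st (i (Fin.last 0))).2.2.1 d hu
      simpa using this
    | succ k ih =>
      intro i hi hg u hu
      rw [Fin.sum_univ_castSucc, hIter_add]
      refine ih (fun t => i t.castSucc) (hi.comp Fin.strictMono_castSucc) ?_ _ ?_
      · intro t
        have := hg t.castSucc
        simpa using this
      · have h1 := hg (Fin.last k)
        have h2 : i (Fin.last k).castSucc < i (Fin.last k).succ := hi Fin.castSucc_lt_succ
        rw [Fin.succ_last] at h1 h2
        change i (Fin.last (k + 1)) - i (Fin.last k).castSucc ≤ d at h1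
        change i (Fin.last k).castSucc < i (Fin.last (k + 1)) at h2
        obtain ⟨r, hr⟩ : ∃ r, i (Fin.last (k + 1)) = i (Fin.last k).castSucc + 1 + r :=
          ⟨i (Fin.last (k + 1)) - i (Fin.last k).castSucc - 1, by omega⟩
        refine d4 r _ d (by omega) _ ?_
        rw [← hr]; exact hu
  refine ⟨P, ?_⟩
  rintro _ ⟨k, i, hi, hg, rfl⟩
  exact key k i hi hg x (d3 _)

end forward

end SGRP

/-- `(x, y) ∈ RP^[d]` iff each `N(x, U)` (for `U` an open neighborhood of `y`)
contains an `SG_d`-set; similarly for `RP^[∞]`. -/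
theorem statement6 {X : Type} [MetricSpace X] [CompactSpace X] (T : X ≃ₜ X)
    (hmin : MinimalTDS T) (d : ℕ) (hd : 1 ≤ d) (x y : X) :
    (RPd T d x y ↔
      ∀ U : Set X, IsOpen U → y ∈ U → ∃ P : ℕ → ℤ, SG d P ⊆ Nset T x U) ∧
    ((∀ e : ℕ, 1 ≤ e → RPd T e x y) ↔
      ∀ U : Set X, IsOpen U → y ∈ U → ∀ e : ℕ, 1 ≤ e →
        ∃ P : ℕ → ℤ, SG e P ⊆ Nset T x U) := by
  refine ⟨⟨fun h U hU hy => SGRP.SG_of_RPd T hmin h U hU hy, SGRP.RPd_of_SG T d hd x y⟩, ?_, ?_⟩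
  · intro h U hU hy e he
    exact SGRP.SG_of_RPd T hmin (h e he) U hU hy
  · intro h e he
    exact SGRP.RPd_of_SG T e he x y fun U hU hy => h U hU hy e he
end

section
/- Let (X,T) be a minimal t.d.s., let d ≥ 1 be an integer and let x, y ∈ X. Then (x,y) ∈ RP^[d] if and only if for every open neighborhood U of y, N(x,U) is a Birkhoff recurrence set of order d. -/
open scoped Classical
open MeasureTheory Filter Topology

section DynAux

set_option linter.unusedSectionVars false
set_option linter.unusedSimpArgs false

theorem hIter_zero {X : Type*} [TopologicalSpace X] (T : X ≃ₜ X) (x : X) : hIter T 0 x = x := by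
  simp [hIter, zIter]

theorem hIter_add {X : Type*} [TopologicalSpace X] (T : X ≃ₜ X) (m n : ℤ) (x : X) :
    hIter T (m + n) x = hIter T m (hIter T n x) := by
  simp [hIter, zIter, zpow_add]

theorem hIter_one {X : Type*} [TopologicalSpace X] (T : X ≃ₜ X) (x : X) : hIter T 1 x = T x := by
  simp [hIter, zIter]

theorem hIter_neg_one {X : Type*} [TopologicalSpace X] (T : X ≃ₜ X) (x : X) :
    hIter T (-1) x = T.symm x := by
  apply T.injective
  rw [← hIter_one T (hIter T (-1) x), ← hIter_add]
  simp [hIter_zero]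

theorem hIter_cont {X : Type*} [TopologicalSpace X] (T : X ≃ₜ X) (n : ℤ) :
    Continuous (hIter T n) := by
  induction n using Int.induction_on with
  | zero =>
    have : hIter T 0 = id := funext (hIter_zero T)
    rw [this]; exact continuous_id
  | succ n ih =>
    have : hIter T ((n : ℤ) + 1) = hIter T n ∘ T := by
      funext x; simp [hIter_add, hIter_one]
    rw [this]; exact ih.comp T.continuous
  | pred n ih =>
    have : hIter T (-(n : ℤ) - 1) = hIter T (-n) ∘ T.symm := by
      funext x; rw [sub_eq_add_neg, hIter_add, hIter_neg_one]; rfl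
    rw [this]; exact ih.comp T.symm.continuous

/-- A semiconjugacy passes to integer iterates. -/
theorem hIter_semi {X Y : Type*} [TopologicalSpace X] [TopologicalSpace Y]
    (R : Y ≃ₜ Y) (T : X ≃ₜ X) (f : Y → X) (h : ∀ y, f (R y) = T (f y)) (n : ℤ) (y : Y) :
    f (hIter R n y) = hIter T n (f y) := by
  induction n using Int.induction_on generalizing y with
  | zero => simp [hIter_zero]
  | succ n ih => rw [hIter_add, hIter_add, ih, hIter_one, hIter_one, h]
  | pred n ih =>
    rw [sub_eq_add_neg, hIter_add, hIter_add, ih, hIter_neg_one, hIter_neg_one]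
    congr 1
    apply T.injective
    rw [← h]; simp

instance endTop (X : Type*) [TopologicalSpace X] : TopologicalSpace (Function.End X) :=
  inferInstanceAs (TopologicalSpace (X → X))

instance endT2 (X : Type*) [TopologicalSpace X] [T2Space X] : T2Space (Function.End X) :=
  inferInstanceAs (T2Space (X → X))

instance endCompact (X : Type*) [TopologicalSpace X] [CompactSpace X] :
    CompactSpace (Function.End X) :=
  inferInstanceAs (CompactSpace (X → X))

theorem end_eval_cont {X : Type*} [TopologicalSpace X] (x : X) :
    Continuous (fun f : Function.End X => f x) :=
  continuous_apply (A := fun _ : X => X) x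

theorem end_mul_right {X : Type*} [TopologicalSpace X] (q : Function.End X) :
    Continuous (fun p : Function.End X => p * q) :=
  continuous_pi (A := fun _ : X => X) fun x => end_eval_cont (q x)

theorem end_mul_left {X : Type*} [TopologicalSpace X] (q : Function.End X) (hq : Continuous (q : X → X)) :
    Continuous (fun p : Function.End X => q * p) :=
  continuous_pi (A := fun _ : X => X) fun x => hq.comp (end_eval_cont x)

theorem closure_mul_mem {M : Type*} [Mul M] [TopologicalSpace M] (A : Set M)
    (hA : ∀ a ∈ A, ∀ b ∈ A, a * b ∈ A) (hl : ∀ a ∈ A, Continuous fun p : M => a * p)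
    (hr : ∀ q : M, Continuous fun p : M => p * q) :
    ∀ p ∈ closure A, ∀ q ∈ closure A, p * q ∈ closure A := by
  have h1 : ∀ a ∈ A, ∀ q ∈ closure A, a * q ∈ closure A := fun a ha q hq =>
    map_mem_closure (hl a ha) hq (fun b hb => hA a ha b hb)
  intro p hp q hq
  have := map_mem_closure (t := closure A) (hr q) hp (fun a ha => h1 a ha q hq)
  rwa [closure_closure] at this

variable {X : Type*} [MetricSpace X] [CompactSpace X] {ι : Type*} [DecidableEq ι]

def tz (T : X ≃ₜ X) (n : ℤ) : Function.End X := hIter T n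

theorem tz_add (T : X ≃ₜ X) (m n : ℤ) : tz T (m + n) = tz T m * tz T n :=
  funext fun x => hIter_add T m n x

theorem tz_zero (T : X ≃ₜ X) : tz T 0 = 1 := funext fun x => hIter_zero T x

def EE (T : X ≃ₜ X) : Set (Function.End X) := closure (Set.range (tz T))

def cub (T : X ≃ₜ X) (J : Finset ι) (n : ι → ℤ) : Finset ι → Function.End X :=
  fun ε => tz T (∑ i ∈ ε ∩ J, n i)

def EJ (T : X ≃ₜ X) (J : Finset ι) : Set (Finset ι → Function.End X) :=
  closure (Set.range (cub T J))

def QJ (T : X ≃ₜ X) (J : Finset ι) : Set (Finset ι → X) :=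
  closure {z | ∃ (x : X) (n : ι → ℤ), z = fun ε => cub T J n ε x}

theorem tz_mem (T : X ≃ₜ X) (n : ℤ) : tz T n ∈ EE T := subset_closure ⟨n, rfl⟩

theorem EE_mul (T : X ≃ₜ X) : ∀ p ∈ EE T, ∀ q ∈ EE T, p * q ∈ EE T := by
  apply closure_mul_mem
  · rintro _ ⟨m, rfl⟩ _ ⟨n, rfl⟩
    exact ⟨m + n, tz_add T m n⟩
  · rintro _ ⟨m, rfl⟩
    exact end_mul_left _ (hIter_cont T m)
  · exact end_mul_right

theorem EE_compact (T : X ≃ₜ X) : IsCompact (EE T) := isClosed_closure.isCompact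

theorem P_mul_right (q : Finset ι → Function.End X) :
    Continuous fun p : Finset ι → Function.End X => p * q :=
  continuous_pi fun ε => (end_mul_right (q ε)).comp (continuous_apply ε)

theorem cub_add (T : X ≃ₜ X) (J : Finset ι) (m n : ι → ℤ) :
    cub T J (m + n) = cub T J m * cub T J n := by
  funext ε
  simp only [cub, Pi.mul_apply, Pi.add_apply, Finset.sum_add_distrib, tz_add]

theorem EJ_mul (T : X ≃ₜ X) (J : Finset ι) : ∀ p ∈ EJ T J, ∀ q ∈ EJ T J, p * q ∈ EJ T J := by
  apply closure_mul_mem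
  · rintro _ ⟨m, rfl⟩ _ ⟨n, rfl⟩
    exact ⟨m + n, cub_add T J m n⟩
  · rintro _ ⟨m, rfl⟩
    exact continuous_pi fun ε => (end_mul_left _ (hIter_cont T _)).comp (continuous_apply ε)
  · exact P_mul_right

theorem EJ_compact (T : X ≃ₜ X) (J : Finset ι) : IsCompact (EJ T J) := isClosed_closure.isCompact

theorem EJ_proj (T : X ≃ₜ X) (J : Finset ι) {h : Finset ι → Function.End X} (hh : h ∈ EJ T J)
    (ε : Finset ι) : h ε ∈ EE T := by
  refine map_mem_closure (f := fun h : Finset ι → Function.End X => h ε)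
    (continuous_apply ε) hh ?_
  rintro _ ⟨n, rfl⟩
  exact ⟨_, rfl⟩

theorem EJ_restrict (T : X ≃ₜ X) {J J' : Finset ι} (hJ : J ⊆ J') {h : Finset ι → Function.End X}
    (hh : h ∈ EJ T J') : (fun ε => h (ε ∩ J)) ∈ EJ T J := by
  refine map_mem_closure (f := fun h : Finset ι → Function.End X => fun ε => h (ε ∩ J))
    (continuous_pi fun ε => continuous_apply _) hh ?_
  rintro _ ⟨n, rfl⟩
  refine ⟨n, ?_⟩
  funext ε
  simp only [cub]
  rw [Finset.inter_assoc, Finset.inter_eq_left.2 hJ]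

theorem EJ_mono (T : X ≃ₜ X) {J J' : Finset ι} (hJ : J ⊆ J') : EJ T J ⊆ EJ T J' := by
  apply closure_mono
  rintro _ ⟨n, rfl⟩
  refine ⟨fun i => if i ∈ J then n i else 0, ?_⟩
  funext ε
  simp only [cub]
  congr 1
  rw [← Finset.sum_filter]
  congr 1
  ext i
  simp only [Finset.mem_filter, Finset.mem_inter]
  constructor
  · rintro ⟨⟨a, b⟩, c⟩; exact ⟨a, c⟩
  · rintro ⟨a, b⟩; exact ⟨⟨a, hJ b⟩, b⟩

theorem EJ_inter (T : X ≃ₜ X) {J : Finset ι} {h : Finset ι → Function.End X}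
    (hh : h ∈ EJ T J) (ε : Finset ι) : h (ε ∩ J) = h ε := by
  have hc : IsClosed {h : Finset ι → Function.End X | h (ε ∩ J) = h ε} :=
    isClosed_eq (continuous_apply _) (continuous_apply _)
  refine closure_minimal ?_ hc hh
  rintro _ ⟨n, rfl⟩
  simp [cub, Finset.inter_assoc]

theorem EJ_empty (T : X ≃ₜ X) {J : Finset ι} {h : Finset ι → Function.End X}
    (hh : h ∈ EJ T J) : h ∅ = 1 := by
  have hc : IsClosed {h : Finset ι → Function.End X | h ∅ = 1} :=
    isClosed_eq (continuous_apply _) continuous_const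
  refine closure_minimal ?_ hc hh
  rintro _ ⟨n, rfl⟩
  simp [cub, tz_zero]

theorem EJ_empty' (T : X ≃ₜ X) {J : Finset ι} {h : Finset ι → Function.End X}
    (hh : h ∈ EJ T J) {ε : Finset ι} (hε : ¬ (ε ∩ J).Nonempty) : h ε = 1 := by
  rw [← EJ_inter T hh, Finset.not_nonempty_iff_eq_empty.1 hε, EJ_empty T hh]

theorem EJ_one (T : X ≃ₜ X) (J : Finset ι) : (1 : Finset ι → Function.End X) ∈ EJ T J := by
  refine subset_closure ⟨0, ?_⟩
  funext ε
  simp [cub, tz_zero]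

theorem EJ_face (T : X ≃ₜ X) {J : Finset ι} {j : ι} (hj : j ∈ J) {v : Function.End X}
    (hv : v ∈ EE T) : (fun ε : Finset ι => if j ∈ ε then v else 1) ∈ EJ T J := by
  refine map_mem_closure (f := fun v : Function.End X => fun ε : Finset ι => if j ∈ ε then v else 1)
    (continuous_pi fun ε => ?_) hv ?_
  · by_cases h : j ∈ ε
    · simp only [h, if_true]; exact continuous_id
    · simpa [h] using continuous_const
  · rintro _ ⟨n, rfl⟩
    refine ⟨Pi.single j n, ?_⟩
    funext ε
    by_cases h : j ∈ ε
    · simp [cub, h, hj, Finset.sum_pi_single]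
    · simp [cub, h, Finset.sum_pi_single, tz_zero]

def uJ (J : Finset ι) (v : Function.End X) : Finset ι → Function.End X :=
  fun ε => if (ε ∩ J).Nonempty then v else 1

theorem uJ_mem (T : X ≃ₜ X) {v : Function.End X} (hv : v ∈ EE T) (hvv : v * v = v)
    (J : Finset ι) : uJ J v ∈ EJ T J := by
  induction J using Finset.induction_on with
  | empty =>
    have : uJ (∅ : Finset ι) v = 1 := by funext ε; simp [uJ]
    rw [this]; exact EJ_one T _
  | insert j J hj ih =>
    have h1 := EJ_mul T _ _ (EJ_face T (Finset.mem_insert_self j J) hv) _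
      (EJ_mono T (Finset.subset_insert j J) ih)
    convert h1 using 1
    funext ε
    simp only [uJ, Pi.mul_apply]
    by_cases h : j ∈ ε
    · have : (ε ∩ insert j J).Nonempty := ⟨j, by simp [h]⟩
      by_cases h' : (ε ∩ J).Nonempty <;> simp [h, h', this, hvv]
    · rw [Finset.inter_insert_of_notMem h]
      simp [h]

structure MinIdem (T : X ≃ₜ X) (u : Function.End X) : Prop where
  mem : u ∈ EE T
  idem : u * u = u
  min : ∀ q ∈ EE T, ∃ r ∈ EE T, r * (q * u) = u

theorem exists_minIdem (T : X ≃ₜ X) (hmin : MinimalTDS T) (x : X) :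
    ∃ u, MinIdem T u ∧ u x = x := by
  let S : Set (Set (Function.End X)) :=
    {L | IsClosed L ∧ L.Nonempty ∧ L ⊆ EE T ∧ ∀ q ∈ EE T, ∀ l ∈ L, q * l ∈ L}
  have hES : EE T ∈ S := ⟨isClosed_closure, ⟨_, tz_mem T 0⟩, subset_rfl, EE_mul T⟩
  obtain ⟨L, hLE, hL⟩ := zorn_superset_nonempty S (by
    intro c hc hchain hne
    refine ⟨⋂₀ c, ⟨isClosed_sInter fun s hs => (hc hs).1, ?_, ?_, ?_⟩,
      fun s hs => Set.sInter_subset_of_mem hs⟩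
    · have := hne.to_subtype
      rw [Set.sInter_eq_iInter]
      apply IsCompact.nonempty_iInter_of_directed_nonempty_isCompact_isClosed
      · intro a b
        rcases hchain.total a.2 b.2 with h | h
        · exact ⟨a, subset_rfl, h⟩
        · exact ⟨b, h, subset_rfl⟩
      · exact fun i => (hc i.2).2.1
      · exact fun i => (hc i.2).1.isCompact
      · exact fun i => (hc i.2).1
    · obtain ⟨s, hs⟩ := hne
      exact (Set.sInter_subset_of_mem hs).trans (hc hs).2.2.1
    · intro q hq l hl s hs
      exact (hc hs).2.2.2 q hq l (hl s hs)) (EE T) hES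
  obtain ⟨hLc, hLne, hLs, hLi⟩ := hL.prop
  -- some element of `L` sends `x` to `x`
  have hx : ∃ q ∈ L, q x = x := by
    obtain ⟨l, hl⟩ := hLne
    have hcl : IsClosed ((fun f : Function.End X => f x) '' L) :=
      (hLc.isCompact.image (end_eval_cont x)).isClosed
    have hd : closure (Set.range fun n : ℤ => hIter T n (l x)) ⊆
        (fun f : Function.End X => f x) '' L := by
      apply closure_minimal _ hcl
      rintro _ ⟨n, rfl⟩
      exact ⟨tz T n * l, hLi _ (tz_mem T n) _ hl, rfl⟩
    exact hd (hmin (l x) x)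
  have hSc : IsClosed (L ∩ {q | q x = x}) :=
    hLc.inter (isClosed_eq (end_eval_cont x) continuous_const)
  obtain ⟨u, ⟨huL, hux⟩, huu⟩ := exists_idempotent_in_compact_subsemigroup end_mul_right
    (L ∩ {q : Function.End X | q x = x}) (by obtain ⟨q, h1, h2⟩ := hx; exact ⟨q, h1, h2⟩) hSc.isCompact
    (by
      rintro a ⟨ha, hax⟩ b ⟨hb, hbx⟩
      refine ⟨hLi _ (hLs ha) _ hb, ?_⟩
      change a (b x) = x
      rw [show b x = x from hbx]; exact hax)
  refine ⟨u, ⟨hLs huL, huu, ?_⟩, hux⟩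
  intro q hq
  have hS : (fun r => r * (q * u)) '' EE T ∈ S := by
    refine ⟨((EE_compact T).image (end_mul_right _)).isClosed, ⟨_, _, hq, rfl⟩, ?_, ?_⟩
    · rintro _ ⟨r, hr, rfl⟩
      exact EE_mul T _ hr _ (EE_mul T _ hq _ (hLs huL))
    · rintro p hp _ ⟨r, hr, rfl⟩
      exact ⟨p * r, EE_mul T _ hp _ hr, mul_assoc _ _ _⟩
  have hsub : (fun r => r * (q * u)) '' EE T ⊆ L := by
    rintro _ ⟨r, hr, rfl⟩
    exact hLi _ hr _ (hLi _ hq _ huL)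
  have := hL.le_of_le hS hsub huL
  obtain ⟨r, hr, h⟩ := this
  exact ⟨r, hr, h⟩


structure InG (T : X ≃ₜ X) (u g : Function.End X) : Prop where
  mem : g ∈ EE T
  left : u * g = g
  right : g * u = g

theorem MinIdem.idem' {T : X ≃ₜ X} {u : Function.End X} (hu : MinIdem T u) (a : Function.End X) :
    u * (u * a) = u * a := by rw [← mul_assoc, hu.idem]

theorem MinIdem.sandwich {T : X ≃ₜ X} {u : Function.End X} (hu : MinIdem T u)
    {q : Function.End X} (hq : q ∈ EE T) : InG T u (u * q * u) :=
  ⟨EE_mul T _ (EE_mul T _ hu.mem _ hq) _ hu.mem, by simp only [mul_assoc, hu.idem'],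
    by simp only [mul_assoc, hu.idem]⟩

theorem MinIdem.left_id {T : X ≃ₜ X} {u v : Function.End X} (hu : MinIdem T u) (hv : v ∈ EE T)
    (hvv : v * v = v) (hvu : v * u = v) : u * v = u := by
  obtain ⟨r, -, hr⟩ := hu.min v hv
  rw [hvu] at hr
  calc u * v = r * v * v := by rw [hr]
    _ = r * v := by rw [mul_assoc, hvv]
    _ = u := hr

theorem InG.left_inv {T : X ≃ₜ X} {u g : Function.End X} (hu : MinIdem T u) (hg : InG T u g) :
    ∃ r, InG T u r ∧ r * g = u := by
  obtain ⟨r, hr, h⟩ := hu.min g hg.mem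
  refine ⟨u * r * u, hu.sandwich hr, ?_⟩
  rw [hg.right] at h
  rw [mul_assoc, hg.left, mul_assoc, h, hu.idem]

theorem InG.comm_inv {T : X ≃ₜ X} {u g r : Function.End X} (hu : MinIdem T u) (hg : InG T u g)
    (hr : InG T u r) (h : r * g = u) : g * r = u := by
  obtain ⟨s, hs, hsr⟩ := hr.left_inv hu
  have : g = s := by
    calc g = u * g := hg.left.symm
      _ = s * (r * g) := by rw [← hsr, mul_assoc]
      _ = s := by rw [h, hs.right]
  rw [this, hsr]

theorem uJ_mul_self {T : X ≃ₜ X} {u : Function.End X} (hu : MinIdem T u) (J : Finset ι) :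
    uJ J u * uJ J u = uJ J u := by
  funext ε
  simp only [uJ, Pi.mul_apply]
  split_ifs
  · exact hu.idem
  · exact one_mul _

theorem EJ_ret {T : X ≃ₜ X} {u : Function.End X} (hu : MinIdem T u) {J : Finset ι}
    {h : Finset ι → Function.End X} (hh : h ∈ EJ T J) :
    ∃ h' ∈ EJ T J, h' * (h * uJ J u) = uJ J u := by
  have hU := uJ_mem T hu.mem hu.idem J
  have hk : h * uJ J u ∈ EJ T J := EJ_mul T J _ hh _ hU
  obtain ⟨v, ⟨h1, hh1, rfl⟩, hvv⟩ := exists_idempotent_in_compact_subsemigroup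
    (P_mul_right (ι := ι) (X := X))
    ((fun p => p * (h * uJ J u)) '' EJ T J) ⟨_, _, hh, rfl⟩
    ((EJ_compact T J).image (P_mul_right _)) (by
      rintro _ ⟨a, ha, rfl⟩ _ ⟨b, hb, rfl⟩
      exact ⟨a * (h * uJ J u) * b, EJ_mul T J _ (EJ_mul T J _ ha _ hk) _ hb, mul_assoc _ _ _⟩)
  refine ⟨uJ J u * h1, EJ_mul T J _ hU _ hh1, ?_⟩
  rw [mul_assoc]
  simp only at hvv
  set v := h1 * (h * uJ J u) with hv
  have hvE : v ∈ EJ T J := EJ_mul T J _ hh1 _ hk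
  have hvu : v * uJ J u = v := by rw [hv, mul_assoc, mul_assoc, uJ_mul_self hu]
  funext ε
  by_cases hε : (ε ∩ J).Nonempty
  · have e : uJ J u ε = u := by simp [uJ, hε]
    have h2 := congrFun hvu ε
    simp only [Pi.mul_apply, e] at h2 ⊢
    exact hu.left_id (EJ_proj T J hvE ε) (congrFun hvv ε) h2
  · have e : uJ J u ε = 1 := by simp [uJ, hε]
    simp only [Pi.mul_apply, e, EJ_empty' T hvE hε, mul_one]

def HJ (T : X ≃ₜ X) (u : Function.End X) (J : Finset ι) : Set (Finset ι → Function.End X) :=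
  {k | ∃ h ∈ EJ T J, k = fun ε => u * h ε * u}

theorem HJ_inG {T : X ≃ₜ X} {u : Function.End X} (hu : MinIdem T u) {J : Finset ι}
    {k : Finset ι → Function.End X} (hk : k ∈ HJ T u J) (ε : Finset ι) : InG T u (k ε) := by
  obtain ⟨h, hh, rfl⟩ := hk
  exact hu.sandwich (EJ_proj T J hh ε)

theorem HJ_mul {T : X ≃ₜ X} {u : Function.End X} (hu : MinIdem T u) {J : Finset ι}
    {k k' : Finset ι → Function.End X} (hk : k ∈ HJ T u J) (hk' : k' ∈ HJ T u J) :
    k * k' ∈ HJ T u J := by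
  obtain ⟨h, hh, rfl⟩ := hk
  obtain ⟨h', hh', rfl⟩ := hk'
  refine ⟨h * uJ J u * h', EJ_mul T J _ (EJ_mul T J _ hh _ (uJ_mem T hu.mem hu.idem J)) _ hh', ?_⟩
  funext ε
  simp only [Pi.mul_apply]
  by_cases hε : (ε ∩ J).Nonempty
  · have e : uJ J u ε = u := by simp [uJ, hε]
    rw [e]; simp only [mul_assoc, hu.idem']
  · have e : uJ J u ε = 1 := by simp [uJ, hε]
    rw [e, EJ_empty' T hh hε, EJ_empty' T hh' hε]
    simp only [mul_assoc, one_mul, mul_one, hu.idem]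

theorem HJ_inv {T : X ≃ₜ X} {u : Function.End X} (hu : MinIdem T u) {J : Finset ι}
    {k : Finset ι → Function.End X} (hk : k ∈ HJ T u J) :
    ∃ k' ∈ HJ T u J, (∀ ε, k' ε * k ε = u) ∧ ∀ ε, k ε * k' ε = u := by
  have hk0 := hk
  obtain ⟨h, hh, rfl⟩ := hk
  have hU := uJ_mem T hu.mem hu.idem J
  obtain ⟨h', hh', e'⟩ := EJ_ret hu (EJ_mul T J _ hU _ hh)
  have hk' : (fun ε => u * h' ε * u) ∈ HJ T u J := ⟨h', hh', rfl⟩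
  have key : ∀ ε, (u * h' ε * u) * (u * h ε * u) = u := by
    intro ε
    have e := congrFun e' ε
    simp only [Pi.mul_apply] at e
    by_cases hε : (ε ∩ J).Nonempty
    · have e1 : uJ J u ε = u := by simp [uJ, hε]
      rw [e1] at e
      simp only [mul_assoc, hu.idem'] at e ⊢
      rw [e, hu.idem]
    · rw [EJ_empty' T hh hε, EJ_empty' T hh' hε]
      simp only [mul_assoc, one_mul, mul_one, hu.idem]
  exact ⟨_, hk', key, fun ε => (HJ_inG hu hk0 ε).comm_inv hu (HJ_inG hu hk' ε) (key ε)⟩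

theorem HJ_face {T : X ≃ₜ X} {u : Function.End X} (hu : MinIdem T u) {J : Finset ι} {j : ι}
    (hj : j ∈ J) {g : Function.End X} (hg : InG T u g) :
    (fun ε : Finset ι => if j ∈ ε then g else u) ∈ HJ T u J := by
  refine ⟨_, EJ_face T hj hg.mem, ?_⟩
  funext ε
  by_cases h : j ∈ ε
  · simp [h, hg.left, hg.right]
  · simp [h, hu.idem]

theorem HJ_conj {T : X ≃ₜ X} {u : Function.End X} (hu : MinIdem T u) {g g' : Function.End X}
    (hg : InG T u g) (hg' : InG T u g') (h1 : g * g' = u) (J : Finset ι) :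
    ∀ k ∈ HJ T u J, (fun ε => g * k ε * g') ∈ HJ T u J := by
  have h2 : g' * g = u := hg'.comm_inv hu hg h1
  induction J using Finset.induction_on with
  | empty =>
    rintro _ ⟨h, hh, rfl⟩
    refine ⟨h, hh, ?_⟩
    funext ε
    have : h ε = 1 := EJ_empty' T hh (by simp)
    simp only [this, mul_one, hu.idem, hg.right, h1]
  | insert j J hj ih =>
    intro k hk
    have hsub := Finset.subset_insert j J
    -- the bottom part
    have hk0 : (fun ε => k (ε ∩ J)) ∈ HJ T u J := by
      obtain ⟨h, hh, rfl⟩ := hk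
      exact ⟨_, EJ_restrict T hsub hh, rfl⟩
    have mono : HJ T u J ⊆ HJ T u (insert j J) := by
      rintro _ ⟨h, hh, rfl⟩
      exact ⟨h, EJ_mono T hsub hh, rfl⟩
    have hbot : ∀ ε, j ∉ ε → k (ε ∩ J) = k ε := by
      obtain ⟨h, hh, rfl⟩ := hk
      intro ε hε
      have := EJ_inter T hh ε
      rw [Finset.inter_insert_of_notMem hε] at this
      simp only [this]
    obtain ⟨l, hl, hl1, hl2⟩ := HJ_inv hu (mono hk0)
    have hm := HJ_mul hu hl hk
    have hc := HJ_mul hu (mono (ih _ hk0))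
      (HJ_mul hu (HJ_mul hu (HJ_face hu (Finset.mem_insert_self j J) hg) hm)
        (HJ_face hu (Finset.mem_insert_self j J) hg'))
    convert hc using 1
    funext ε
    have hkG := HJ_inG hu hk ε
    simp only [Pi.mul_apply]
    have hl2' := hl2 ε
    have hl1' := hl1 ε
    by_cases h : j ∈ ε
    · simp only [h, if_true]
      calc g * k ε * g' = g * (u * k ε) * g' := by rw [hkG.left]
        _ = g * (k (ε ∩ J) * l ε * k ε) * g' := by rw [hl2']
        _ = g * (k (ε ∩ J) * u * l ε * k ε) * g' := by rw [(HJ_inG hu hk (ε ∩ J)).right]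
        _ = _ := by rw [← h2]; simp only [mul_assoc]
    · simp only [h, if_false]
      rw [hbot ε h] at hl1' ⊢
      rw [hl1', hu.idem, hu.idem, mul_assoc (g * k ε), hg'.right]

/-- Points of `Q` are mapped to points of `Q`. -/
theorem QJ_act (T : X ≃ₜ X) {J : Finset ι} {h : Finset ι → Function.End X} (hh : h ∈ EJ T J)
    {z : Finset ι → X} (hz : z ∈ QJ T J) : (fun ε => h ε (z ε)) ∈ QJ T J := by
  have hc : Continuous fun h : Finset ι → Function.End X => fun ε => h ε (z ε) :=
    continuous_pi fun ε => (end_eval_cont (z ε)).comp (continuous_apply ε)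
  have := map_mem_closure (t := QJ T J) hc hh ?_
  · rwa [QJ, closure_closure] at this
  rintro _ ⟨n, rfl⟩
  refine map_mem_closure (f := fun z : Finset ι → X => fun ε => cub T J n ε (z ε))
    (continuous_pi fun ε => (hIter_cont T _).comp (continuous_apply ε)) hz ?_
  rintro _ ⟨x, m, rfl⟩
  refine ⟨x, n + m, ?_⟩
  rw [cub_add]; rfl

theorem QJ_diag (T : X ≃ₜ X) {J : Finset ι} {p : Function.End X} (hp : p ∈ EE T)
    {z : Finset ι → X} (hz : z ∈ QJ T J) : (fun ε => p (z ε)) ∈ QJ T J := by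
  have hc : Continuous fun p : Function.End X => fun ε => p (z ε) :=
    continuous_pi fun ε => end_eval_cont (z ε)
  have := map_mem_closure (t := QJ T J) hc hp ?_
  · rwa [QJ, closure_closure] at this
  rintro _ ⟨n, rfl⟩
  refine map_mem_closure (f := fun z : Finset ι → X => fun ε => tz T n (z ε))
    (continuous_pi fun ε => (hIter_cont T _).comp (continuous_apply ε)) hz ?_
  rintro _ ⟨x, m, rfl⟩
  refine ⟨tz T n x, m, ?_⟩
  funext ε
  change hIter T _ (hIter T _ x) = hIter T _ (hIter T _ x)
  rw [← hIter_add, ← hIter_add, add_comm]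

theorem exists_EE (T : X ≃ₜ X) (hmin : MinimalTDS T) (x y : X) : ∃ p ∈ EE T, p x = y := by
  have hcl : IsClosed ((fun f : Function.End X => f x) '' EE T) :=
    ((EE_compact T).image (end_eval_cont x)).isClosed
  have hd : closure (Set.range fun n : ℤ => hIter T n x) ⊆
      (fun f : Function.End X => f x) '' EE T := by
    apply closure_minimal _ hcl
    rintro _ ⟨n, rfl⟩
    exact ⟨tz T n, tz_mem T n, rfl⟩
  exact hd (hmin x y)

theorem mem_EJ_orbit (T : X ≃ₜ X) (J : Finset ι) (x : X) (z : Finset ι → X)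
    (hz : z ∈ closure (Set.range fun n : ι → ℤ => fun ε => cub T J n ε x)) :
    ∃ h ∈ EJ T J, ∀ ε, h ε x = z ε := by
  have hc : Continuous fun h : Finset ι → Function.End X => fun ε => h ε x :=
    continuous_pi fun ε => (end_eval_cont x).comp (continuous_apply ε)
  have hcl := ((EJ_compact T J).image hc).isClosed
  have : closure (Set.range fun n : ι → ℤ => fun ε => cub T J n ε x) ⊆
      (fun h : Finset ι → Function.End X => fun ε => h ε x) '' EJ T J := by
    apply closure_minimal _ hcl
    rintro _ ⟨n, rfl⟩
    exact ⟨_, subset_closure ⟨n, rfl⟩, rfl⟩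
  obtain ⟨h, hh, e⟩ := this hz
  exact ⟨h, hh, fun ε => congrFun e ε⟩

theorem exists_generic [Finite ι] [Nonempty X] (T : X ≃ₜ X) (J : Finset ι) :
    ∃ x₀ : X, ∀ z ∈ QJ T J, z ∅ = x₀ → ∃ h ∈ EJ T J, ∀ ε, h ε x₀ = z ε := by
  let D : Set (Finset ι → X) → Set X := fun B => {x | ∃ n : ι → ℤ, (fun ε => cub T J n ε x) ∈ B}
  have hD : ∀ B, IsOpen B → IsOpen (D B) := by
    intro B hB
    have : D B = ⋃ n : ι → ℤ, (fun x => fun ε => cub T J n ε x) ⁻¹' B := by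
      ext x; simp [D]
    rw [this]
    exact isOpen_iUnion fun n => hB.preimage (continuous_pi fun ε => hIter_cont T _)
  have : SecondCountableTopology (Finset ι → X) := inferInstance
  let 𝓑 := TopologicalSpace.countableBasis (Finset ι → X)
  have hdense : Dense (⋂ B ∈ 𝓑, (frontier (D B))ᶜ) := by
    apply dense_biInter_of_isOpen
    · exact fun B _ => isClosed_frontier.isOpen_compl
    · exact TopologicalSpace.countable_countableBasis _
    · intro B hB
      rw [← interior_eq_empty_iff_dense_compl]
      rw [← frontier_compl]
      exact interior_frontier (hD B (TopologicalSpace.isOpen_of_mem_countableBasis hB)).isClosed_compl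
  obtain ⟨x₀, hx₀⟩ := hdense.nonempty
  refine ⟨x₀, fun z hz hz0 => mem_EJ_orbit T J x₀ z ?_⟩
  rw [(TopologicalSpace.isBasis_countableBasis (Finset ι → X)).mem_closure_iff]
  intro B hB hzB
  by_contra hne
  have h1 : x₀ ∉ D B := by
    rintro ⟨n, hn⟩
    exact hne ⟨_, hn, n, rfl⟩
  have h2 : x₀ ∉ frontier (D B) := by
    simp only [Set.mem_iInter] at hx₀
    exact hx₀ B hB
  have h3 : x₀ ∉ closure (D B) := by
    intro h
    refine h2 ⟨h, ?_⟩
    intro h'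
    exact h1 (interior_subset h')
  have hop : IsOpen (B ∩ (fun z : Finset ι → X => z ∅) ⁻¹' (closure (D B))ᶜ) :=
    (TopologicalSpace.isOpen_of_mem_countableBasis hB).inter
      (isClosed_closure.isOpen_compl.preimage (continuous_apply _))
  obtain ⟨_, ⟨hwB, hw⟩, x', n, rfl⟩ := mem_closure_iff.1 hz _ hop ⟨hzB, by
    rw [← hz0] at h3; exact h3⟩
  apply hw
  have : cub T J n ∅ x' = x' := by simp [cub, tz_zero]; rfl
  change cub T J n ∅ x' ∈ _
  rw [this]
  exact subset_closure ⟨n, hwB⟩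

theorem QJ_return [Finite ι] (T : X ≃ₜ X) (hmin : MinimalTDS T) (J : Finset ι)
    (z : Finset ι → X) (hz : z ∈ QJ T J) : ∃ h ∈ EJ T J, ∀ ε, h ε (z ε) = z ∅ := by
  obtain ⟨x, hx⟩ : ∃ x, x = z ∅ := ⟨_, rfl⟩
  rw [← hx]
  have : Nonempty X := ⟨x⟩
  obtain ⟨u, hu, hux⟩ := exists_minIdem T hmin x
  obtain ⟨x₀, hx₀⟩ := exists_generic T J
  have hU := uJ_mem T hu.mem hu.idem J
  -- `z` only depends on `ε ∩ J`
  have hzJ : ∀ ε, z (ε ∩ J) = z ε := by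
    intro ε
    refine closure_minimal ?_ (isClosed_eq (continuous_apply (ε ∩ J)) (continuous_apply ε)) hz
    rintro _ ⟨x, n, rfl⟩
    simp [cub, Finset.inter_assoc]
  have hz1 := QJ_act T hU hz
  set z1 : Finset ι → X := fun ε => uJ J u ε (z ε) with hz1d
  have hz1e : ∀ ε, ¬ (ε ∩ J).Nonempty → z1 ε = x := by
    intro ε hε
    have e : uJ J u ε = 1 := by simp [uJ, hε]
    simp only [hz1d, e]
    rw [hx, ← hzJ ε, Finset.not_nonempty_iff_eq_empty.1 hε]; rfl
  have hz1u : ∀ ε, u (z1 ε) = z1 ε := by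
    intro ε
    by_cases hε : (ε ∩ J).Nonempty
    · have e : uJ J u ε = u := by simp [uJ, hε]
      simp only [hz1d, e]
      exact congrFun hu.idem (z ε)
    · rw [hz1e ε hε, hux]
  obtain ⟨p0, hp0, hp0x⟩ := exists_EE T hmin x x₀
  have hpE : p0 * u ∈ EE T := EE_mul T _ hp0 _ hu.mem
  have hg : InG T u (u * p0 * u) := hu.sandwich hp0
  obtain ⟨r, hr, hrg⟩ := hg.left_inv hu
  set p := p0 * u with hp
  have hpu : p * u = p := by rw [hp, mul_assoc, hu.idem]
  have hrp : r * p = u := by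
    rw [← hr.right, mul_assoc, hp, ← mul_assoc u, hrg]
  have hpx : p x = x₀ := by
    change p0 (u x) = x₀
    rw [hux, hp0x]
  obtain ⟨h, hh, hhz⟩ := hx₀ _ (QJ_diag T hpE hz1) (by
    change p (z1 ∅) = x₀
    rw [hz1e ∅ (by simp), hpx])
  have hpr : (p * r) * (p * r) = p * r := by
    rw [mul_assoc, ← mul_assoc r, hrp, hr.left]
  have hprE : p * r ∈ EE T := EE_mul T _ hpE _ hr.mem
  have hh' := EJ_mul T J _ hh _ (uJ_mem T hprE hpr J)
  have hk : (fun ε => u * (h * uJ J (p * r)) ε * u) ∈ HJ T u J := ⟨_, hh', rfl⟩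
  have hkc := HJ_conj hu hr hg hrg J _ hk
  have hzk : ∀ ε, (r * (u * (h * uJ J (p * r)) ε * u) * (u * p0 * u)) x = z1 ε := by
    intro ε
    by_cases hε : (ε ∩ J).Nonempty
    · have e : uJ J (p * r) ε = p * r := by simp [uJ, hε]
      have e2 : r * (u * (h * uJ J (p * r)) ε * u) * (u * p0 * u) = r * (h ε * p) := by
        simp only [Pi.mul_apply, e]
        calc r * (u * (h ε * (p * r)) * u) * (u * p0 * u)
            = (r * u) * h ε * p * r * (u * (u * p) ) := by
              rw [hp]; simp only [mul_assoc]
          _ = (r * u) * h ε * p * (r * u) * p := by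
              rw [hu.idem']; simp only [mul_assoc]
          _ = r * (h ε * (p * (r * p))) := by
              rw [hr.right]; simp only [mul_assoc]
          _ = r * (h ε * p) := by rw [hrp, hpu]
      rw [e2]
      change r (h ε (p x)) = z1 ε
      rw [hpx, hhz ε]
      change (r * p) (z1 ε) = z1 ε
      rw [hrp, hz1u]
    · rw [EJ_empty' T hh' hε, hz1e ε hε, mul_one, hu.idem, hr.right, hrg, hux]
  obtain ⟨k', ⟨h'', hh'', rfl⟩, hk'1, -⟩ := HJ_inv hu hkc
  refine ⟨uJ J u * h'' * uJ J u, EJ_mul T J _ (EJ_mul T J _ hU _ hh'') _ hU, fun ε => ?_⟩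
  by_cases hε : (ε ∩ J).Nonempty
  · have e : uJ J u ε = u := by simp [uJ, hε]
    change uJ J u ε (h'' ε (z1 ε)) = x
    rw [e, ← hz1u ε, ← hzk ε]
    have := congrFun (hk'1 ε) x
    rw [hux] at this
    exact this
  · have e : uJ J u ε = 1 := by simp [uJ, hε]
    change uJ J u ε (h'' ε (z1 ε)) = x
    rw [e, EJ_empty' T hh'' hε, hz1e ε hε]; rfl

theorem le_zero_of_inv {a : ℝ} (h : ∀ k : ℕ, a ≤ 1 / ((k : ℝ) + 1)) : a ≤ 0 :=
  ge_of_tendsto' tendsto_one_div_add_atTop_nhds_zero_nat h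

theorem sum_noNone {d : ℕ} (ε : Finset (Option (Fin d))) (hε : none ∉ ε)
    (f : Option (Fin d) → ℤ) : ∑ i ∈ ε, f i = ∑ i ∈ ε.eraseNone, f (some i) := by
  have h := Finset.map_some_eraseNone ε
  rw [Finset.erase_eq_of_notMem hε] at h
  conv_lhs => rw [← h]
  rw [Finset.sum_map]
  rfl

theorem eraseNone_ne {d : ℕ} (ε : Finset (Option (Fin d))) (hε : none ∉ ε)
    (hne : ε.Nonempty) : ε.eraseNone.Nonempty := by
  obtain ⟨i, hi⟩ := hne
  cases i with
  | none => exact absurd hi hε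
  | some i => exact ⟨i, by simpa using hi⟩

theorem step_one {W : Type*} [MetricSpace W] [CompactSpace W] (R : W ≃ₜ W) (hR : MinimalTDS R)
    (T : X ≃ₜ X) (π : W → X) (hπ : Continuous π) (hs : ∀ w, π (R w) = T (π w))
    (hsurj : Function.Surjective π) (d : ℕ) (x y : X) (h : RPd T d x y) :
    ∃ z ∈ QJ R (Finset.univ : Finset (Option (Fin d))), π (z ∅) = x ∧ π (z {none}) = y ∧
      ∀ ε, none ∉ ε → ε.Nonempty → π (z ε) = π (z (insert none ε)) := by
  let C : ℕ → Set (Finset (Option (Fin d)) → W) := fun k =>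
    QJ R Finset.univ ∩ {z | dist x (π (z ∅)) ≤ 1 / ((k : ℝ) + 1) ∧
      dist y (π (z {none})) ≤ 1 / ((k : ℝ) + 1) ∧
      ∀ ε, none ∉ ε → ε.Nonempty → dist (π (z ε)) (π (z (insert none ε))) ≤ 1 / ((k : ℝ) + 1)}
  have hpc : ∀ ε, Continuous fun z : Finset (Option (Fin d)) → W => π (z ε) :=
    fun ε => hπ.comp (continuous_apply ε)
  have hcl : ∀ k, IsClosed (C k) := by
    intro k
    refine isClosed_closure.inter ?_
    simp only [Set.ofPred_and, Set.ofPred_forall]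
    refine (isClosed_le (continuous_const.dist (hpc _)) continuous_const).inter
      ((isClosed_le (continuous_const.dist (hpc _)) continuous_const).inter ?_)
    exact isClosed_iInter fun ε => isClosed_iInter fun _ => isClosed_iInter fun _ =>
      isClosed_le ((hpc _).dist (hpc _)) continuous_const
  have hne : ∀ k, (C k).Nonempty := by
    intro k
    have hδ : (0 : ℝ) < 1 / ((k : ℝ) + 1) := by positivity
    set δ := 1 / ((k : ℝ) + 1)
    obtain ⟨x', y', n, hx, hy, hn⟩ := h δ hδ
    obtain ⟨w1, rfl⟩ := hsurj x'
    obtain ⟨w2, rfl⟩ := hsurj y'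
    have hG : IsOpen {w : W | dist y (π w) < δ ∧ ∀ ε : Finset (Fin d), ε.Nonempty →
        dist (hIter T (∑ i ∈ ε, n i) (π w1)) (hIter T (∑ i ∈ ε, n i) (π w)) < δ} := by
      simp only [Set.ofPred_and, Set.ofPred_forall]
      refine (isOpen_lt (continuous_const.dist hπ) continuous_const).inter ?_
      exact isOpen_iInter_of_finite fun ε => isOpen_iInter_of_finite fun _ =>
        isOpen_lt (continuous_const.dist ((hIter_cont T _).comp hπ)) continuous_const
    obtain ⟨_, ⟨hm1, hm2⟩, m, rfl⟩ := mem_closure_iff.1 (hR w1 w2) _ hG ⟨hy, hn⟩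
    let n' : Option (Fin d) → ℤ := fun o => o.elim m n
    refine ⟨fun ε => cub R Finset.univ n' ε w1, subset_closure ⟨w1, n', rfl⟩, ?_, ?_, ?_⟩
    · have : cub R Finset.univ n' ∅ w1 = w1 := by simp [cub, tz_zero]; rfl
      change dist x (π (cub R Finset.univ n' ∅ w1)) ≤ _
      rw [this]; exact hx.le
    · have : cub R Finset.univ n' {none} w1 = hIter R m w1 := by simp [cub, n']; rfl
      change dist y (π (cub R Finset.univ n' {none} w1)) ≤ _
      rw [this]; exact hm1.le
    · intro ε h1 h2
      have e1 : cub R Finset.univ n' ε w1 = hIter R (∑ i ∈ ε.eraseNone, n i) w1 := by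
        simp only [cub, Finset.inter_univ, sum_noNone ε h1]; rfl
      have e2 : cub R Finset.univ n' (insert none ε) w1 =
          hIter R (∑ i ∈ ε.eraseNone, n i) (hIter R m w1) := by
        simp only [cub, Finset.inter_univ, Finset.sum_insert h1, sum_noNone ε h1]
        rw [← hIter_add, add_comm]; rfl
      change dist (π (cub R Finset.univ n' ε w1)) (π (cub R Finset.univ n' (insert none ε) w1)) ≤ _
      rw [e1, e2, hIter_semi R T π hs, hIter_semi R T π hs _ (hIter R m w1)]
      exact (hm2 _ (eraseNone_ne ε h1 h2)).le
  obtain ⟨z, hz⟩ := IsCompact.nonempty_iInter_of_sequence_nonempty_isCompact_isClosed C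
    (by
      rintro k z ⟨hz, h1, h2, h3⟩
      have hk : 1 / (((k + 1 : ℕ) : ℝ) + 1) ≤ 1 / ((k : ℝ) + 1) := by
        apply one_div_le_one_div_of_le (by positivity)
        push_cast; linarith
      exact ⟨hz, h1.trans hk, h2.trans hk, fun ε a b => (h3 ε a b).trans hk⟩)
    hne (hcl 0).isCompact hcl
  rw [Set.mem_iInter] at hz
  refine ⟨z, (hz 0).1, ?_, ?_, ?_⟩
  · exact (dist_le_zero.1 (le_zero_of_inv fun k => (hz k).2.1)).symm
  · exact (dist_le_zero.1 (le_zero_of_inv fun k => (hz k).2.2.1)).symm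
  · intro ε a b
    exact dist_le_zero.1 (le_zero_of_inv fun k => (hz k).2.2.2 ε a b)

theorem EE_compat {W : Type*} [MetricSpace W] [CompactSpace W] (R : W ≃ₜ W)
    (T : X ≃ₜ X) (π : W → X) (hπ : Continuous π) (hs : ∀ w, π (R w) = T (π w))
    {h : Function.End W} (hh : h ∈ EE R) {w w' : W} (e : π w = π w') : π (h w) = π (h w') := by
  have hc : IsClosed {h : Function.End W | π (h w) = π (h w')} :=
    isClosed_eq (hπ.comp (end_eval_cont w)) (hπ.comp (end_eval_cont w'))
  refine closure_minimal ?_ hc hh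
  rintro _ ⟨n, rfl⟩
  change π (hIter R n w) = π (hIter R n w')
  rw [hIter_semi R T π hs, hIter_semi R T π hs, e]

theorem lift_thm {W : Type*} [MetricSpace W] [CompactSpace W] (R : W ≃ₜ W) (hR : MinimalTDS R)
    (T : X ≃ₜ X) (π : W → X) (hπ : Continuous π) (hs : ∀ w, π (R w) = T (π w))
    (hsurj : Function.Surjective π) (d : ℕ) (x y : X) (h : RPd T d x y) :
    ∃ wx wy : W, ∀ (O : Set W) (U : Set X), IsOpen O → IsOpen U → wy ∈ O → y ∈ U →
      ∃ n : Option (Fin d) → ℤ, ∀ ε : Finset (Option (Fin d)), ε.Nonempty →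
        hIter T (∑ i ∈ ε, n i) x ∈ U ∧ (none ∈ ε → hIter R (∑ i ∈ ε, n i) wx ∈ O) := by
  obtain ⟨z, hz, hzx, hzy, hzp⟩ := step_one R hR T π hπ hs hsurj d x y h
  set J : Finset (Option (Fin d)) := Finset.univ.erase none with hJ
  have hz' : (fun ε : Finset (Option (Fin d)) => z (insert none (ε ∩ J))) ∈ QJ R J := by
    refine map_mem_closure (f := fun z : Finset (Option (Fin d)) → W =>
      fun ε : Finset (Option (Fin d)) => z (insert none (ε ∩ J)))
      (continuous_pi fun ε => continuous_apply _) hz ?_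
    rintro _ ⟨w, n, rfl⟩
    refine ⟨hIter R (n none) w, n, ?_⟩
    funext ε
    have hn : none ∉ ε ∩ J := by simp [hJ]
    change hIter R _ w = hIter R _ (hIter R _ w)
    rw [← hIter_add, Finset.inter_univ, Finset.sum_insert hn, add_comm]
  obtain ⟨g, hg, hgz⟩ := QJ_return R hR J _ hz'
  have hz2 : (fun ε => g ε (z ε)) ∈ QJ R Finset.univ :=
    QJ_act R (EJ_mono R (Finset.subset_univ J) hg) hz
  have hJe : insert none ((∅ : Finset (Option (Fin d))) ∩ J) = {none} := by simp
  simp only [hJe] at hgz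
  set wy := z {none} with hwy
  have hA : ∀ ε, none ∈ ε → g ε (z ε) = wy := by
    intro ε hε
    have e : insert none (ε ∩ J) = ε := by
      ext i
      by_cases hi : i = none
      · simp [hi, hε]
      · simp [hi, hJ]
    have := hgz ε
    rwa [e] at this
  have hB : ∀ ε, none ∉ ε → ε.Nonempty → π (g ε (z ε)) = y := by
    intro ε h1 h2
    rw [EE_compat R T π hπ hs (EJ_proj R J hg ε) (hzp ε h1 h2)]
    have e : ε ∩ J = ε := by
      apply Finset.inter_eq_left.2
      intro i hi
      simp only [hJ, Finset.mem_erase, Finset.mem_univ, and_true]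
      rintro rfl
      exact h1 hi
    have := hgz ε
    rw [e] at this
    rw [this, hzy]
  have hC : g ∅ (z ∅) = z ∅ := by rw [EJ_empty R hg]; rfl
  obtain ⟨k, hk, hkz⟩ := QJ_return R hR Finset.univ _ hz2
  simp only [hC] at hkz
  obtain ⟨u, hu, huw⟩ := exists_minIdem R hR wy
  obtain ⟨l, hl, hlk⟩ := EJ_ret hu hk
  have hlk' : ∀ ε : Finset (Option (Fin d)), ε.Nonempty → l ε (k ε wy) = wy := by
    intro ε hε
    have e : uJ Finset.univ u ε = u := by simp [uJ, hε]
    have h1 := congrFun (congrFun hlk ε) wy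
    change l ε (k ε (uJ Finset.univ u ε wy)) = uJ Finset.univ u ε wy at h1
    rwa [e, huw] at h1
  have hAA : ∀ ε, none ∈ ε → l ε (z ∅) = wy := by
    intro ε hε
    rw [← hkz ε, hA ε hε, hlk' ε ⟨_, hε⟩]
  have hBB : ∀ ε : Finset (Option (Fin d)), ε.Nonempty → π (l ε (z ∅)) = y := by
    intro ε hε
    by_cases h1 : none ∈ ε
    · rw [hAA ε h1, hzy]
    · have e1 : π (g ε (z ε)) = π wy := by rw [hB ε h1 hε, hzy]
      rw [← hkz ε, EE_compat R T π hπ hs (EJ_proj R _ hl ε)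
        (EE_compat R T π hπ hs (EJ_proj R _ hk ε) e1), hlk' ε hε, hzy]
  refine ⟨z ∅, wy, fun O U hO hU hwO hyU => ?_⟩
  have hop : IsOpen {f : Finset (Option (Fin d)) → Function.End W | ∀ ε, ε.Nonempty →
      π (f ε (z ∅)) ∈ U ∧ (none ∈ ε → f ε (z ∅) ∈ O)} := by
    have hc : ∀ ε, Continuous fun f : Finset (Option (Fin d)) → Function.End W => f ε (z ∅) :=
      fun ε => (end_eval_cont (z ∅)).comp (continuous_apply ε)
    simp only [Set.ofPred_forall, Set.ofPred_and]
    exact isOpen_iInter_of_finite fun ε => isOpen_iInter_of_finite fun _ =>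
      (hU.preimage (hπ.comp (hc ε))).inter
        (isOpen_iInter_of_finite fun _ => hO.preimage (hc ε))
  obtain ⟨_, hf, n, rfl⟩ := mem_closure_iff.1 hl _ hop (by
    intro ε hε
    refine ⟨by rw [hBB ε hε]; exact hyU, fun h1 => by rw [hAA ε h1]; exact hwO⟩)
  refine ⟨n, fun ε hε => ?_⟩
  have := hf ε hε
  simp only [cub, Finset.inter_univ] at this
  refine ⟨?_, this.2⟩
  rw [← hzx, ← hIter_semi R T π hs]
  exact this.1

theorem exists_min_sub {Z : Type*} [MetricSpace Z] [CompactSpace Z] [Nonempty Z] (F : Z ≃ₜ Z) :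
    ∃ L : Set Z, IsClosed L ∧ L.Nonempty ∧ (∀ n : ℤ, ∀ z ∈ L, hIter F n z ∈ L) ∧
      ∀ z ∈ L, L ⊆ closure (Set.range fun n : ℤ => hIter F n z) := by
  let S : Set (Set Z) := {L | IsClosed L ∧ L.Nonempty ∧ ∀ n : ℤ, ∀ z ∈ L, hIter F n z ∈ L}
  obtain ⟨L, -, hL⟩ := zorn_superset_nonempty S (by
    intro c hc hchain hne
    refine ⟨⋂₀ c, ⟨isClosed_sInter fun s hs => (hc hs).1, ?_, ?_⟩,
      fun s hs => Set.sInter_subset_of_mem hs⟩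
    · have := hne.to_subtype
      rw [Set.sInter_eq_iInter]
      apply IsCompact.nonempty_iInter_of_directed_nonempty_isCompact_isClosed
      · intro a b
        rcases hchain.total a.2 b.2 with h | h
        · exact ⟨a, subset_rfl, h⟩
        · exact ⟨b, h, subset_rfl⟩
      · exact fun i => (hc i.2).2.1
      · exact fun i => (hc i.2).1.isCompact
      · exact fun i => (hc i.2).1
    · intro n l hl s hs
      exact (hc hs).2.2 n l (hl s hs)) Set.univ
    ⟨isClosed_univ, Set.univ_nonempty, fun _ _ _ => Set.mem_univ _⟩
  obtain ⟨hLc, hLne, hLi⟩ := hL.prop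
  refine ⟨L, hLc, hLne, hLi, fun z hz => ?_⟩
  refine hL.le_of_le ⟨isClosed_closure, ⟨_, subset_closure ⟨0, rfl⟩⟩, ?_⟩ ?_
  · intro n w hw
    refine map_mem_closure (hIter_cont F n) hw ?_
    rintro _ ⟨m, rfl⟩
    exact ⟨n + m, hIter_add F n m z⟩
  · refine closure_minimal ?_ hLc
    rintro _ ⟨m, rfl⟩
    exact hLi m z hz

def subHomeo {Z : Type*} [TopologicalSpace Z] (F : Z ≃ₜ Z) (L : Set Z)
    (h : ∀ n : ℤ, ∀ z ∈ L, hIter F n z ∈ L) : L ≃ₜ L where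
  toFun z := ⟨hIter F 1 z, h 1 z z.2⟩
  invFun z := ⟨hIter F (-1) z, h (-1) z z.2⟩
  left_inv z := Subtype.ext (by
    change hIter F (-1) (hIter F 1 z) = z
    rw [← hIter_add]; exact hIter_zero F z)
  right_inv z := Subtype.ext (by
    change hIter F 1 (hIter F (-1) z) = z
    rw [← hIter_add]; exact hIter_zero F z)
  continuous_toFun := ((hIter_cont F 1).comp continuous_subtype_val).subtype_mk _
  continuous_invFun := ((hIter_cont F (-1)).comp continuous_subtype_val).subtype_mk _

theorem subHomeo_iter {Z : Type*} [TopologicalSpace Z] (F : Z ≃ₜ Z) (L : Set Z)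
    (h : ∀ n : ℤ, ∀ z ∈ L, hIter F n z ∈ L) (n : ℤ) (z : L) :
    ((hIter (subHomeo F L h) n z : L) : Z) = hIter F n z :=
  hIter_semi (subHomeo F L h) F Subtype.val (fun z => hIter_one F z) n z

theorem subHomeo_min {Z : Type*} [TopologicalSpace Z] (F : Z ≃ₜ Z) (L : Set Z)
    (h : ∀ n : ℤ, ∀ z ∈ L, hIter F n z ∈ L)
    (hm : ∀ z ∈ L, L ⊆ closure (Set.range fun n : ℤ => hIter F n z)) :
    MinimalTDS (subHomeo F L h) := by
  intro z
  rw [Subtype.dense_iff]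
  refine (hm z z.2).trans (closure_mono ?_)
  rintro _ ⟨n, rfl⟩
  exact ⟨_, ⟨n, rfl⟩, subHomeo_iter F L h n z⟩

theorem forward {X : Type} [MetricSpace X] [CompactSpace X] (T : X ≃ₜ X)
    (hmin : MinimalTDS T) (d : ℕ) (x y : X) (h : RPd T d x y) (U : Set X) (hU : IsOpen U)
    (hy : y ∈ U) : BirkhoffRecSet d (Nset T x U) := by
  intro Y _ _ S hS V hV hVne
  obtain ⟨v0, hv0⟩ := hVne
  have : Nonempty (X × Y) := ⟨(x, v0)⟩
  obtain ⟨L, hLc, ⟨l0, hl0⟩, hLi, hLm⟩ := exists_min_sub (T.prodCongr S)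
  have : CompactSpace L := isCompact_iff_compactSpace.1 hLc.isCompact
  have hR := subHomeo_min _ L hLi hLm
  set R := subHomeo (T.prodCongr S) L hLi with hRd
  have hs1 : ∀ w : L, (R w).1.1 = T w.1.1 := fun w => by
    change (hIter (T.prodCongr S) 1 w).1 = _
    rw [hIter_one]; rfl
  have hs2 : ∀ w : L, (R w).1.2 = S w.1.2 := fun w => by
    change (hIter (T.prodCongr S) 1 w).2 = _
    rw [hIter_one]; rfl
  have hc1 : Continuous fun w : L => w.1.1 := continuous_fst.comp continuous_subtype_val
  have hc2 : Continuous fun w : L => w.1.2 := continuous_snd.comp continuous_subtype_val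
  have hsurj : Function.Surjective fun w : L => w.1.1 := by
    intro x1
    have hcl : IsClosed (Set.range fun w : L => w.1.1) := (isCompact_range hc1).isClosed
    have : closure (Set.range fun n : ℤ => hIter T n l0.1) ⊆ Set.range fun w : L => w.1.1 := by
      refine closure_minimal ?_ hcl
      rintro _ ⟨n, rfl⟩
      exact ⟨hIter R n ⟨l0, hl0⟩, hIter_semi R T (fun w : L => w.1.1) hs1 n ⟨l0, hl0⟩⟩
    exact this (hmin l0.1 x1)
  obtain ⟨wx, wy, hw⟩ := lift_thm R hR T (fun w : L => w.1.1) hc1 hs1 hsurj d x y h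
  obtain ⟨_, hj, j, rfl⟩ := mem_closure_iff.1 (hS wy.1.2 v0) V hV hv0
  obtain ⟨n, hn⟩ := hw {w | hIter S j w.1.2 ∈ V} U
    (hV.preimage ((hIter_cont S j).comp hc2)) hU hj hy
  have hmap : ∀ I : Finset (Fin d), none ∉ I.map Function.Embedding.some := by simp
  refine ⟨fun i => n (some i), ?_, hIter S (j + n none) wx.1.2, ?_, ?_⟩
  · rintro _ ⟨I, hI, rfl⟩
    have := (hn (I.map Function.Embedding.some) (hI.map)).1
    rw [Finset.sum_map] at this
    exact this
  · have := (hn {none} (by simp)).2 (by simp)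
    simp only [Finset.sum_singleton, Set.mem_ofPred_eq] at this
    rw [hIter_semi R S (fun w : L => w.1.2) hs2, ← hIter_add] at this
    exact this
  · simp only [Set.mem_iInter]
    rintro _ ⟨I, hI, rfl⟩
    have := (hn (insert none (I.map Function.Embedding.some)) (by simp)).2 (by simp)
    rw [Finset.sum_insert (hmap I), Finset.sum_map] at this
    simp only [Set.mem_ofPred_eq] at this
    rw [hIter_semi R S (fun w : L => w.1.2) hs2, ← hIter_add] at this
    change hIter S _ (hIter S _ _) ∈ V
    rw [← hIter_add]
    convert this using 2
    simp only [Function.Embedding.some_apply]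
    ring

theorem backward {X : Type} [MetricSpace X] [CompactSpace X] (T : X ≃ₜ X)
    (hmin : MinimalTDS T) (d : ℕ) (x y : X)
    (h : ∀ U : Set X, IsOpen U → y ∈ U → BirkhoffRecSet d (Nset T x U)) : RPd T d x y := by
  intro δ hδ
  have hy : y ∈ Metric.ball y (δ / 2) := Metric.mem_ball_self (by linarith)
  obtain ⟨n, hn, z, hz, hzn⟩ := h _ Metric.isOpen_ball hy X T hmin _ Metric.isOpen_ball ⟨y, hy⟩
  refine ⟨x, z, n, by simpa using hδ, ?_, fun ε hε => ?_⟩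
  · rw [dist_comm]
    have := Metric.mem_ball.1 hz
    linarith
  · have hm : (∑ i ∈ ε, n i) ∈ FS n := ⟨ε, hε, rfl⟩
    have h1 : dist _ y < δ / 2 := hn hm
    simp only [Set.mem_iInter] at hzn
    have h2 : dist _ y < δ / 2 := hzn _ hm
    have := dist_triangle_right (hIter T (∑ i ∈ ε, n i) x) (hIter T (∑ i ∈ ε, n i) z) y
    linarith

end DynAux

/-- `(x, y) ∈ RP^[d]` iff every `N(x, U)` is a Birkhoff recurrence set of order `d`. -/
theorem statement9 {X : Type} [MetricSpace X] [CompactSpace X] (T : X ≃ₜ X)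
    (hmin : MinimalTDS T) (d : ℕ) (hd : 1 ≤ d) (x y : X) :
    RPd T d x y ↔
      ∀ U : Set X, IsOpen U → y ∈ U → BirkhoffRecSet d (Nset T x U) :=
  ⟨fun h U hU hy => forward T hmin d x y h U hU hy, backward T hmin d x y⟩
end
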